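/- arXiv:1307.0369 — 2 statements merged into one kernel-verified Lean document; each statement's English description precedes it below -/
import Mathlib

section
/- Let (R, m) be a commutative noetherian local ring and M a finitely generated R-module of finite CI-dimension. Then there exists a quasi-deformation R → R' ← Q such that pd_Q(R' ⊗_R M) < ∞ and the closed fibre R'/mR' is an artinian Gorenstein ring. -/
/-!
STATEMENT 16: If M is a finitely generated module of finite CI-dimension over a
commutative noetherian local ring R, then there is a quasi-deformation
R → R' ← Q with pd_Q(R' ⊗_R M) < ∞ whose closed fibre R'/mR' is artinian and
Gorenstein.
-/

open CategoryTheory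

/-- `Ext^i_R(M, N)` for `R`-modules `M`, `N`. -/
noncomputable def extMod (R : Type) [CommRing R] (M N : ModuleCat R) (i : ℕ) : ModuleCat R :=
  ((Ext R (ModuleCat R) i).obj (Opposite.op M)).obj N

/-- An `R`-module `C` has finite projective dimension iff there is `n` such that
`Ext^i_R(C, N) = 0` for every module `N` and every `i > n`. -/
def HasFiniteProjectiveDimension (R : Type) [CommRing R] (C : ModuleCat R) : Prop :=
  ∃ n : ℕ, ∀ (N : ModuleCat R) (i : ℕ), n < i → Subsingleton (extMod R C N i)

/-- A commutative ring is Gorenstein if it has finite injective dimension over itself. -/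
def IsGorenstein (R : Type) [CommRing R] : Prop :=
  ∃ n : ℕ, ∀ (M : ModuleCat R) (i : ℕ), n < i → Subsingleton (extMod R M (ModuleCat.of R R) i)

/-- A diagram `R →φ R' ←τ Q` of noetherian local rings is a quasi-deformation if `φ` is
flat local and `τ` is a local surjection whose kernel is generated by a `Q`-regular
sequence. -/
def IsQuasiDeformation (R R' Q : Type) [CommRing R] [CommRing R'] [CommRing Q]
    [IsNoetherianRing R] [IsNoetherianRing R'] [IsNoetherianRing Q]
    [IsLocalRing R] [IsLocalRing R'] [IsLocalRing Q]
    (φ : R →+* R') (τ : Q →+* R') : Prop :=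
  IsLocalHom φ ∧ IsLocalHom τ ∧
    (letI : Algebra R R' := φ.toAlgebra; Module.Flat R R') ∧
    Function.Surjective τ ∧
    ∃ rs : List Q, RingTheory.Sequence.IsRegular Q rs ∧
      RingHom.ker τ = Ideal.span {q | q ∈ rs}

/-- `R' ⊗_R M`, viewed as a `Q`-module via `τ : Q →+* R'`. -/
noncomputable def baseChangeAsQModule (R R' Q : Type) [CommRing R] [CommRing R'] [CommRing Q]
    (φ : R →+* R') (τ : Q →+* R')
    (M : Type) [AddCommGroup M] [Module R M] : ModuleCat Q :=
  letI : Algebra R R' := φ.toAlgebra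
  (ModuleCat.restrictScalars τ).obj (ModuleCat.of R' (TensorProduct R R' M))

/-- `M` has finite CI-dimension: there is a quasi-deformation `R → R' ← Q` such that
`R' ⊗_R M` has finite projective dimension over `Q`. -/
def HasFiniteCIDimension (R : Type) [CommRing R] [IsNoetherianRing R] [IsLocalRing R]
    (M : Type) [AddCommGroup M] [Module R M] [Module.Finite R M] : Prop :=
  ∃ (R' Q : Type) (_ : CommRing R') (_ : CommRing Q)
    (_ : IsNoetherianRing R') (_ : IsNoetherianRing Q)
    (_ : IsLocalRing R') (_ : IsLocalRing Q)
    (φ : R →+* R') (τ : Q →+* R'),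
      IsQuasiDeformation R R' Q φ τ ∧
        HasFiniteProjectiveDimension Q (baseChangeAsQModule R R' Q φ τ M)

section

/-- The derived-functor `Ext` groups vanish exactly when the Yoneda `Ext` groups do. -/
theorem subsingleton_extMod_succ_iff (R : Type) [CommRing R] (M N : ModuleCat R) (n : ℕ) :
    Subsingleton (extMod R M N (n + 1)) ↔ ∀ e : Abelian.Ext.{0} M N (n + 1), e = 0 := by
  let P := projectiveResolution M
  have h1 : Subsingleton (extMod R M N (n + 1)) ↔
      ∀ f : P.complex.X (n + 1) ⟶ N, P.complex.d (n + 2) (n + 1) ≫ f = 0 →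
        ∃ g : P.complex.X n ⟶ N, P.complex.d (n + 1) n ≫ g = f := by
    rw [← ModuleCat.isZero_iff_subsingleton]
    unfold extMod
    rw [(P.isoExt (R := R) (n + 1) N).isZero_iff,
      ← HomologicalComplex.exactAt_iff_isZero_homology,
      HomologicalComplex.exactAt_iff' _ n (n + 1) (n + 2) (by simp) (by simp),
      ShortComplex.moduleCat_exact_iff]
    rfl
  rw [h1]
  constructor
  · intro h e
    obtain ⟨f, hf, rfl⟩ := P.extMk_surjective e (n + 2) rfl
    exact (P.extMk_eq_zero_iff f (n + 2) rfl hf n rfl).2 (h f hf)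
  · intro h f hf
    exact (P.extMk_eq_zero_iff f (n + 2) rfl hf n rfl).1 (h _)

theorem hasFiniteProjectiveDimension_iff (R : Type) [CommRing R] (M : ModuleCat R) :
    HasFiniteProjectiveDimension R M ↔ ∃ n : ℕ, HasProjectiveDimensionLE M n := by
  refine exists_congr fun n ↦ ?_
  refine Iff.trans ?_ (hasProjectiveDimensionLT_iff.{0} M (n + 1)).symm
  constructor
  · rintro h (_ | i) hi Y e
    · simp at hi
    · exact (subsingleton_extMod_succ_iff R M Y i).1 (h Y (i + 1) hi) e
  · rintro h N (_ | i) hi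
    · simp at hi
    · exact (subsingleton_extMod_succ_iff R M N i).2 fun e ↦ h (i + 1) hi e

theorem isGorenstein_of_baer (R : Type) [CommRing R] (h : Module.Baer R R) : IsGorenstein R := by
  refine ⟨0, ?_⟩
  rintro M (_ | i) hi
  · simp at hi
  · rw [subsingleton_extMod_succ_iff]
    have := h.injective
    have : Injective (ModuleCat.of R R) := Module.injective_object_of_injective_module R R
    exact fun e ↦ Abelian.Ext.eq_zero_of_injective e

end

section

section Balancing

open TensorProduct LinearMap

variable {R : Type*} [CommRing R]
  {A B C K P N : Type*} [AddCommGroup A] [AddCommGroup B] [AddCommGroup C]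
  [AddCommGroup K] [AddCommGroup P] [AddCommGroup N]
  [Module R A] [Module R B] [Module R C] [Module R K] [Module R P] [Module R N]

/-- The diagram chase behind the balancing of `Tor`. -/
theorem lTensor_injective_of_rTensor_injective
    {f : A →ₗ[R] B} {g : B →ₗ[R] C} (hfg : Function.Exact f g) (hg : Function.Surjective g)
    {k : K →ₗ[R] P} {p : P →ₗ[R] N} (hkp : Function.Exact k p) (hp : Function.Surjective p)
    (hf : Function.Injective (f.rTensor N)) (hk : Function.Injective (k.lTensor B)) :
    Function.Injective (k.lTensor C) := by
  rw [injective_iff_map_eq_zero]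
  intro c hc
  obtain ⟨b, rfl⟩ := rTensor_surjective K hg c
  have h1 : g.rTensor P (k.lTensor B b) = 0 := by
    rw [← hc, ← LinearMap.comp_apply, ← LinearMap.comp_apply, rTensor_comp_lTensor,
      lTensor_comp_rTensor]
  obtain ⟨a, ha⟩ := (rTensor_exact P hfg hg _).1 h1
  have h2 : p.lTensor A a = 0 := by
    apply hf
    have : f.rTensor N (p.lTensor A a) = p.lTensor B (f.rTensor P a) := by
      rw [← LinearMap.comp_apply, ← LinearMap.comp_apply, rTensor_comp_lTensor,
      lTensor_comp_rTensor]
    rw [this, ha, map_zero]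
    exact (lTensor_exact B hkp hp _).2 ⟨b, rfl⟩
  obtain ⟨a', rfl⟩ := (lTensor_exact A hkp hp _).1 h2
  have h3 : f.rTensor K a' = b := by
    apply hk
    rw [← ha, ← LinearMap.comp_apply, ← LinearMap.comp_apply, rTensor_comp_lTensor,
      lTensor_comp_rTensor]
  rw [← h3]
  exact (rTensor_exact K hfg hg _).2 ⟨a', rfl⟩

theorem rTensor_injective_of_lTensor_injective
    {f : A →ₗ[R] B} {g : B →ₗ[R] C} (hfg : Function.Exact f g) (hg : Function.Surjective g)
    {k : K →ₗ[R] P} {p : P →ₗ[R] N} (hkp : Function.Exact k p) (hp : Function.Surjective p)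
    (hk : Function.Injective (k.lTensor C)) (hf : Function.Injective (f.rTensor P)) :
    Function.Injective (f.rTensor N) := by
  rw [← lTensor_inj_iff_rTensor_inj] at hf ⊢
  rw [lTensor_inj_iff_rTensor_inj] at hk
  exact lTensor_injective_of_rTensor_injective hkp hp hfg hg hk hf

end Balancing

section Flat

open TensorProduct LinearMap

variable {R : Type*} [CommRing R] {A B C : Type*} [AddCommGroup A] [AddCommGroup B]
  [AddCommGroup C] [Module R A] [Module R B] [Module R C]
  {f : A →ₗ[R] B} {g : B →ₗ[R] C}

theorem rTensor_injective_of_flat_cokernel [Module.Flat R C] (hf : Function.Injective f)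
    (hfg : Function.Exact f g) (hg : Function.Surjective g)
    (N : Type*) [AddCommGroup N] [Module R N] : Function.Injective (f.rTensor N) := by
  let p : (N →₀ R) →ₗ[R] N := Finsupp.linearCombination R id
  have hp : Function.Surjective p := Finsupp.linearCombination_id_surjective R N
  exact rTensor_injective_of_lTensor_injective hfg hg (exact_subtype_ker_map p) hp
    (Module.Flat.lTensor_preserves_injective_linearMap _ (Submodule.injective_subtype _))
    (Module.Flat.rTensor_preserves_injective_linearMap _ hf)

theorem flat_of_flat_of_exact [Module.Flat R B] [Module.Flat R C] (hf : Function.Injective f)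
    (hfg : Function.Exact f g) (hg : Function.Surjective g) : Module.Flat R A := by
  rw [Module.Flat.iff_lTensor_injective]
  intro I _
  have h1 : Function.Injective (I.subtype.lTensor B ∘ₗ f.rTensor I) :=
    (Module.Flat.lTensor_preserves_injective_linearMap _ (Submodule.injective_subtype _)).comp
      (rTensor_injective_of_flat_cokernel hf hfg hg I)
  rw [lTensor_comp_rTensor, ← rTensor_comp_lTensor, coe_comp] at h1
  exact h1.of_comp

end Flat

section Surjective

open TensorProduct

variable {R : Type*} [CommRing R] {S : Type*} [CommRing S] [Algebra R S]
  {X : Type*} [AddCommGroup X] [Module R X]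

theorem one_tmul_eq_zero_iff (hS : Function.Surjective (algebraMap R S)) {I : Ideal R}
    (hker : RingHom.ker (algebraMap R S) = I) (v : X) :
    (1 : S) ⊗ₜ[R] v = 0 ↔ v ∈ (I • ⊤ : Submodule R X) := by
  let e : (R ⧸ I) ≃ₗ[R] S :=
    (Submodule.quotEquivOfEq _ _ (by ext x; rw [← hker]; rfl)).trans
      ((Algebra.linearMap R S).quotKerEquivOfSurjective hS)
  have he : e (Ideal.Quotient.mk _ 1) = 1 := (algebraMap R S).map_one
  rw [← (TensorProduct.congr e (LinearEquiv.refl R X)).symm.map_eq_zero_iff,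
    ← (quotTensorEquivQuotSMul X I).map_eq_zero_iff, ← Submodule.Quotient.mk_eq_zero,
    TensorProduct.congr_symm_tmul, ← he, e.symm_apply_apply, quotTensorEquivQuotSMul_mk_tmul,
    one_smul]
  rfl

theorem exists_eq_one_tmul (hS : Function.Surjective (algebraMap R S)) (z : S ⊗[R] X) :
    ∃ a : X, z = 1 ⊗ₜ a := by
  induction z with
  | zero => exact ⟨0, by simp⟩
  | tmul s a =>
    obtain ⟨r, rfl⟩ := hS s
    exact ⟨r • a, by rw [Algebra.algebraMap_eq_smul_one, smul_tmul]⟩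
  | add x y hx hy =>
    obtain ⟨a, rfl⟩ := hx
    obtain ⟨b, rfl⟩ := hy
    exact ⟨a + b, by rw [tmul_add]⟩

end Surjective

section WeaklyRegular

open RingTheory.Sequence LinearMap TensorProduct Submodule

variable {R : Type*} [CommRing R]

theorem isWeaklyRegular_of_exact (rs : List R) :
    ∀ {A B C : Type*} [AddCommGroup A] [AddCommGroup B]
      [AddCommGroup C] [Module R A] [Module R B] [Module R C]
      {f : A →ₗ[R] B} {g : B →ₗ[R] C}, Function.Injective f → Function.Exact f g →
      Function.Surjective g → IsWeaklyRegular B rs → IsWeaklyRegular C rs →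
      IsWeaklyRegular A rs := by
  induction rs with
  | nil => intros; simp
  | cons r rs ih =>
    intro A B C _ _ _ _ _ _ f g hf hfg hg hB hC
    rw [isWeaklyRegular_cons_iff] at hB hC ⊢
    refine ⟨hB.1.of_injective f hf, ih ?_ (QuotSMulTop.map_exact r hfg hg)
      (QuotSMulTop.map_surjective r hg) hB.2 hC.2⟩
    have h0 : Function.Exact (0 : PUnit →ₗ[R] A) f := (exact_zero_iff_injective _ _).2 hf
    have h1 := QuotSMulTop.map_first_exact_on_four_term_exact_of_isSMulRegular_last h0 hfg hC.1
    rw [map_zero] at h1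
    exact (exact_zero_iff_injective _ _).1 h1

theorem lTensor_injective_of_isWeaklyRegular {S : Type*} [CommRing S] [Algebra R S]
    (hS : Function.Surjective (algebraMap R S)) {rs : List R}
    (hker : RingHom.ker (algebraMap R S) = Ideal.ofList rs)
    {A B C : Type*} [AddCommGroup A] [AddCommGroup B]
    [AddCommGroup C] [Module R A] [Module R B] [Module R C]
    {f : A →ₗ[R] B} {g : B →ₗ[R] C} (hf : Function.Injective f) (hfg : Function.Exact f g)
    (hg : Function.Surjective g) (hC : IsWeaklyRegular C rs) :
    Function.Injective (f.lTensor S) := by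
  have h0 : Function.Exact (0 : PUnit →ₗ[R] A) f := (exact_zero_iff_injective _ _).2 hf
  have h1 := map_first_exact_on_four_term_right_exact_of_isSMulRegular_last h0 hfg hg hC
  have h2 : ∀ a, f a ∈ (Ideal.ofList rs • ⊤ : Submodule R B) →
      a ∈ (Ideal.ofList rs • ⊤ : Submodule R A) := by
    intro a ha
    have h3 : mapQ _ _ _ (smul_top_le_comap_smul_top (Ideal.ofList rs) f)
        (Submodule.Quotient.mk a) = 0 := by
      simpa using ha
    obtain ⟨b, hb⟩ := (h1 _).1 h3
    obtain ⟨b, rfl⟩ := Submodule.mkQ_surjective _ b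
    rw [← Submodule.Quotient.mk_eq_zero, ← hb]
    simp
  rw [injective_iff_map_eq_zero]
  intro z hz
  obtain ⟨a, rfl⟩ := exists_eq_one_tmul hS z
  rw [lTensor_tmul, one_tmul_eq_zero_iff hS hker] at hz
  rw [one_tmul_eq_zero_iff hS hker]
  exact h2 a hz

end WeaklyRegular

end

section

section BaseChange

open TensorProduct LinearMap

variable {Q : Type} [CommRing Q]

/-- Every flat presentation of `X` stays left exact after tensoring with `N`;
this says that `Tor₁ X N = 0`. -/
def TorOneVanishes (Q : Type) [CommRing Q] (X N : Type) [AddCommGroup X] [Module Q X]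
    [AddCommGroup N] [Module Q N] : Prop :=
  ∀ (F : Type) [AddCommGroup F] [Module Q F] [Module.Flat Q F] (π : F →ₗ[Q] X),
    Function.Surjective π → Function.Injective ((ker π).subtype.rTensor N)

theorem exists_free_presentation (Q N : Type) [CommRing Q] [AddCommGroup N] [Module Q N] :
    ∃ (P : Type) (_ : AddCommGroup P) (_ : Module Q P) (_ : Module.Free Q P) (p : P →ₗ[Q] N),
      Function.Surjective p :=
  ⟨N →₀ Q, inferInstance, inferInstance, inferInstance, Finsupp.linearCombination Q id,
    Finsupp.linearCombination_id_surjective Q N⟩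

theorem shortExact_of_ker_presentation {P N : Type} [AddCommGroup P] [Module Q P]
    [AddCommGroup N] [Module Q N] {K : Type} [AddCommGroup K] [Module Q K]
    {k : K →ₗ[Q] P} {p : P →ₗ[Q] N} (hk : Function.Injective k) (hkp : Function.Exact k p)
    (hp : Function.Surjective p) :
    (ShortComplex.mk (ModuleCat.ofHom k) (ModuleCat.ofHom p) (by
      ext x; exact (hkp _).2 ⟨x, rfl⟩)).ShortExact where
  exact := by
    rw [ShortComplex.ShortExact.moduleCat_exact_iff_function_exact]
    exact hkp
  mono_f := (ModuleCat.mono_iff_injective _).2 hk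
  epi_g := (ModuleCat.epi_iff_surjective _).2 hp

theorem hasProjectiveDimensionLE_succ_iff_of_exact {P N : Type} [AddCommGroup P] [Module Q P]
    [AddCommGroup N] [Module Q N] {K : Type} [AddCommGroup K] [Module Q K] [Module.Projective Q P]
    {k : K →ₗ[Q] P} {p : P →ₗ[Q] N} (hk : Function.Injective k) (hkp : Function.Exact k p)
    (hp : Function.Surjective p) (n : ℕ) :
    HasProjectiveDimensionLE (ModuleCat.of Q N) (n + 1) ↔
      HasProjectiveDimensionLE (ModuleCat.of Q K) n :=
  (shortExact_of_ker_presentation hk hkp hp).hasProjectiveDimensionLT_X₃_iff n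
    ((IsProjective.iff_projective P).1 ‹_›)

theorem hasProjectiveDimensionLE_baseChange
    (𝒞 : ∀ X : Type, [AddCommGroup X] → [Module Q X] → Prop)
    (hker : ∀ (X : Type) [AddCommGroup X] [Module Q X], 𝒞 X →
      ∀ (F : Type) [AddCommGroup F] [Module Q F] [Module.Flat Q F] (π : F →ₗ[Q] X),
        Function.Surjective π → 𝒞 (ker π))
    {S : Type} [CommRing S] [Algebra Q S] (hS : 𝒞 S) (n : ℕ) :
    ∀ (N : Type) [AddCommGroup N] [Module Q N],
      (∀ (X : Type) [AddCommGroup X] [Module Q X], 𝒞 X → TorOneVanishes Q X N) →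
      HasProjectiveDimensionLE (ModuleCat.of Q N) n →
      HasProjectiveDimensionLE (ModuleCat.of S (S ⊗[Q] N)) n := by
  induction n with
  | zero =>
    intro N _ _ _ h
    have : Module.Projective Q N :=
      (IsProjective.iff_projective N).2 (projective_iff_hasProjectiveDimensionLT_one.2 h)
    exact projective_iff_hasProjectiveDimensionLT_one.1
      ((IsProjective.iff_projective (S ⊗[Q] N)).1 inferInstance)
  | succ n ih =>
    intro N _ _ hN h
    obtain ⟨P, _, _, _, p, hp⟩ := exists_free_presentation Q N
    have hkp := exact_subtype_ker_map p
    have bal : ∀ (X : Type) [AddCommGroup X] [Module Q X], 𝒞 X →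
        Function.Injective ((ker p).subtype.lTensor X) := by
      intro X _ _ hX
      obtain ⟨F, _, _, _, π, hπ⟩ := exists_free_presentation Q X
      exact lTensor_injective_of_rTensor_injective (f := (ker π).subtype)
        (exact_subtype_ker_map π) hπ hkp hp
        (hN X hX _ π hπ)
        (Module.Flat.lTensor_preserves_injective_linearMap _ (Submodule.injective_subtype _))
    rw [hasProjectiveDimensionLE_succ_iff_of_exact (Submodule.injective_subtype _) hkp hp] at h
    have h' := ih (ker p) (fun X _ _ hX F _ _ _ π hπ ↦ by
      have h1 : Function.Injective ((ker π).subtype.rTensor P ∘ₗ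
          (ker p).subtype.lTensor (ker π)) :=
        (Module.Flat.rTensor_preserves_injective_linearMap _
          (Submodule.injective_subtype _)).comp (bal _ (hker X hX F π hπ))
      rw [rTensor_comp_lTensor, ← lTensor_comp_rTensor, coe_comp] at h1
      exact h1.of_comp) h
    have e1 : Function.Injective ((ker p).subtype.baseChange S) := bal S hS
    have e2 : Function.Exact ((ker p).subtype.baseChange S) (p.baseChange S) :=
      _root_.lTensor_exact S hkp hp
    have e3 : Function.Surjective (p.baseChange S) := LinearMap.lTensor_surjective S hp
    exact (hasProjectiveDimensionLE_succ_iff_of_exact e1 e2 e3 n).2 h'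

end BaseChange

end

section

section CIDeformation

open TensorProduct LinearMap RingTheory.Sequence

variable {R R' Q : Type} [CommRing R] [CommRing R'] [CommRing Q] [Algebra R R'] [Algebra Q R']
  [SMulCommClass Q R R']

/-- The condition on `Q`-modules under which `Tor^Q(-, R' ⊗ M)` vanishes. -/
def IsRegularWithFlatQuotient (R R' : Type) {Q : Type} [CommRing R] [CommRing R'] [CommRing Q]
    [Algebra R R'] [Algebra Q R'] [SMulCommClass Q R R'] (xs : List Q) (X : Type) [AddCommGroup X]
    [Module Q X] : Prop :=
  IsWeaklyRegular X xs ∧ Module.Flat R (R' ⊗[Q] X)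

theorem IsRegularWithFlatQuotient.ker_of_surjective [Module.Flat R R']
    (hS : Function.Surjective (algebraMap Q R')) {xs : List Q}
    (hker : RingHom.ker (algebraMap Q R') = Ideal.ofList xs) (hQ : IsWeaklyRegular Q xs)
    {X : Type} [AddCommGroup X] [Module Q X] (hX : IsRegularWithFlatQuotient R R' xs X)
    {F : Type} [AddCommGroup F] [Module Q F] [Module.Flat Q F] (π : F →ₗ[Q] X)
    (hπ : Function.Surjective π) : IsRegularWithFlatQuotient R R' xs (ker π) := by
  have hex : Function.Exact (ker π).subtype π := exact_subtype_ker_map π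
  have hinj := Submodule.injective_subtype (ker π)
  have hF : IsWeaklyRegular F xs :=
    ((TensorProduct.rid Q F).isWeaklyRegular_congr xs).1 hQ.isWeaklyRegular_lTensor
  have := hX.2
  have : Module.Flat R (R' ⊗[Q] F) := Module.Flat.trans R R' _
  refine ⟨isWeaklyRegular_of_exact xs hinj hex hπ hF hX.1, ?_⟩
  exact flat_of_flat_of_exact
    (f := ((ker π).subtype.baseChange R').restrictScalars R)
    (g := (π.baseChange R').restrictScalars R)
    (lTensor_injective_of_isWeaklyRegular hS hker hinj hex hπ hX.1)
    (_root_.lTensor_exact R' hex hπ) (LinearMap.lTensor_surjective R' hπ)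

theorem IsRegularWithFlatQuotient.torOneVanishes [SMulCommClass R Q R']
    (hS : Function.Surjective (algebraMap Q R')) {xs : List Q}
    (hker : RingHom.ker (algebraMap Q R') = Ideal.ofList xs)
    (M : Type) [AddCommGroup M] [Module R M]
    {X : Type} [AddCommGroup X] [Module Q X] (hX : IsRegularWithFlatQuotient R R' xs X) :
    TorOneVanishes Q X (R' ⊗[R] M) := by
  intro F _ _ _ π hπ
  have hex : Function.Exact (ker π).subtype π := exact_subtype_ker_map π
  have hinj := Submodule.injective_subtype (ker π)
  have := hX.2
  have h1 : Function.Injective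
      ((((ker π).subtype.baseChange R').restrictScalars R).rTensor M) :=
    rTensor_injective_of_flat_cokernel (g := (π.baseChange R').restrictScalars R)
      (lTensor_injective_of_isWeaklyRegular hS hker hinj hex hπ hX.1)
      (_root_.lTensor_exact R' hex hπ) (LinearMap.lTensor_surjective R' hπ) M
  let e (Y : Type) [AddCommGroup Y] [Module Q Y] :
      (R' ⊗[R] M) ⊗[Q] Y ≃+ (R' ⊗[Q] Y) ⊗[R] M :=
    ((AlgebraTensorModule.cancelBaseChange Q R' R' (R' ⊗[R] M) Y).symm.toAddEquiv.trans
      (TensorProduct.comm R' (R' ⊗[R] M) (R' ⊗[Q] Y)).toAddEquiv).trans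
      (AlgebraTensorModule.cancelBaseChange R R' R' (R' ⊗[Q] Y) M).toAddEquiv
  have he (Y : Type) [AddCommGroup Y] [Module Q Y] (r : R') (m : M) (y : Y) :
      e Y ((r ⊗ₜ m) ⊗ₜ y) = (r ⊗ₜ y) ⊗ₜ m := by
    change (r • ((1 : R') ⊗ₜ[Q] y)) ⊗ₜ[R] m = _
    rw [smul_tmul', smul_eq_mul, mul_one]
  have hcomm : ∀ z, e F ((ker π).subtype.lTensor (R' ⊗[R] M) z) =
      (((ker π).subtype.baseChange R').restrictScalars R).rTensor M (e (ker π) z) := by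
    intro z
    induction z with
    | zero => simp
    | add x y hx hy => simp only [map_add, hx, hy]
    | tmul w y =>
      induction w with
      | zero => simp
      | add x y hx hy => simp only [map_add, add_tmul, hx, hy]
      | tmul r m => rw [lTensor_tmul, he, he, rTensor_tmul]; rfl
  rw [← lTensor_inj_iff_rTensor_inj]
  intro z w hzw
  apply (e _).injective
  apply h1
  rw [← hcomm, ← hcomm, hzw]

theorem hasProjectiveDimensionLE_of_isPushout [SMulCommClass R Q R'] {Q₁ R₁ : Type}
    [CommRing Q₁] [CommRing R₁]
    [Algebra Q Q₁] [Algebra R' R₁] [Algebra Q₁ R₁] [Algebra R R₁] [Algebra Q R₁]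
    [IsScalarTower R R' R₁] [IsScalarTower Q R' R₁] [IsScalarTower Q Q₁ R₁]
    [Algebra.IsPushout Q R' Q₁ R₁] [Module.Flat R R'] [Module.Flat R R₁]
    (hS : Function.Surjective (algebraMap Q R')) {xs : List Q}
    (hker : RingHom.ker (algebraMap Q R') = Ideal.ofList xs) (hQ : IsWeaklyRegular Q xs)
    (hQ₁ : IsWeaklyRegular Q₁ xs) (M : Type) [AddCommGroup M] [Module R M] (n : ℕ)
    (h : HasProjectiveDimensionLE (ModuleCat.of Q (R' ⊗[R] M)) n) :
    HasProjectiveDimensionLE (ModuleCat.of Q₁ (R₁ ⊗[R] M)) n := by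
  have hQ₁' : IsRegularWithFlatQuotient R R' xs Q₁ := by
    refine ⟨hQ₁, ?_⟩
    exact Module.Flat.of_linearEquiv
      ((Algebra.IsPushout.equiv Q R' Q₁ R₁).toLinearEquiv.restrictScalars R)
  have h1 := hasProjectiveDimensionLE_baseChange
    (fun X _ _ ↦ IsRegularWithFlatQuotient R R' xs X)
    (fun X _ _ hX F _ _ _ π hπ ↦ hX.ker_of_surjective hS hker hQ π hπ) hQ₁' n _
    (fun X _ _ hX ↦ hX.torOneVanishes hS hker M) h
  have : Algebra.IsPushout Q Q₁ R' R₁ := Algebra.IsPushout.symm ‹_›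
  let e1 : R₁ ⊗[R'] (R' ⊗[R] M) ≃ₗ[Q₁] Q₁ ⊗[Q] (R' ⊗[R] M) :=
    Algebra.IsPushout.cancelBaseChange Q Q₁ R' R₁ (R' ⊗[R] M)
  let e2 : R₁ ⊗[R'] (R' ⊗[R] M) ≃ₗ[R₁] R₁ ⊗[R] M :=
    AlgebraTensorModule.cancelBaseChange R R' R₁ R₁ M
  let e3 : Q₁ ⊗[Q] (R' ⊗[R] M) ≃ₗ[Q₁] R₁ ⊗[R] M := e1.symm.trans (e2.restrictScalars Q₁)
  exact ModuleCat.hasProjectiveDimensionLE_of_linearEquiv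
    (M := ModuleCat.of Q₁ (Q₁ ⊗[Q] (R' ⊗[R] M))) (N := ModuleCat.of Q₁ (R₁ ⊗[R] M)) e3 n

end CIDeformation

end

section

open TensorProduct in
theorem isPushout_of_surjective {Q S T U : Type*} [CommRing Q] [CommRing S] [CommRing T]
    [CommRing U] [Algebra Q S] [Algebra Q T] [Algebra S U] [Algebra T U] [Algebra Q U]
    [IsScalarTower Q S U] [IsScalarTower Q T U]
    (hS : Function.Surjective (algebraMap Q S)) (hU : Function.Surjective (algebraMap T U))
    (hker : RingHom.ker (algebraMap T U) =
      (RingHom.ker (algebraMap Q S)).map (algebraMap Q T)) :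
    Algebra.IsPushout Q S T U := by
  refine ⟨⟨fun z w hzw ↦ ?_, fun u ↦ ?_⟩⟩
  · obtain ⟨a, rfl⟩ := exists_eq_one_tmul hS z
    obtain ⟨b, rfl⟩ := exists_eq_one_tmul hS w
    have hab : algebraMap T U a = algebraMap T U b := by simpa using hzw
    rw [← sub_eq_zero, ← map_sub, ← RingHom.mem_ker, hker] at hab
    rw [← sub_eq_zero, ← tmul_sub, one_tmul_eq_zero_iff hS rfl, Ideal.smul_top_eq_map]
    exact hab
  · obtain ⟨t, rfl⟩ := hU u
    exact ⟨1 ⊗ₜ t, by simp⟩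

end

section

section Complete

variable {S : Type*} [CommRing S] (I : Ideal S)

theorem isHausdorff_of_injective {M M' : Type*} [AddCommGroup M] [Module S M] [AddCommGroup M']
    [Module S M'] [IsHausdorff I M'] (f : M →ₗ[S] M') (hf : Function.Injective f) :
    IsHausdorff I M := by
  refine ⟨fun x hx ↦ hf ?_⟩
  rw [map_zero]
  refine IsHausdorff.haus ‹_› (f x) fun n ↦ ?_
  have h := hx n
  rw [SModEq.zero] at h ⊢
  have h1 := Submodule.mem_map_of_mem (f := f) h
  rw [Submodule.map_smul''] at h1
  exact Submodule.smul_mono le_rfl le_top h1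

theorem mem_smul_top_pi_iff {ι : Type*} [Finite ι] {v : ι → S} :
    v ∈ (I • ⊤ : Submodule S (ι → S)) ↔ ∀ i, v i ∈ I := by
  classical
  have := Fintype.ofFinite ι
  constructor
  · intro hv i
    have h := Submodule.mem_map_of_mem (f := LinearMap.proj (R := S) (φ := fun _ : ι ↦ S) i) hv
    rw [Submodule.map_smul''] at h
    have h' := Submodule.smul_mono (le_refl I) le_top h
    rwa [smul_eq_mul, Ideal.mul_top] at h'
  · intro hv
    rw [pi_eq_sum_univ' v]
    exact Submodule.sum_mem _ fun i _ ↦ Submodule.smul_mem_smul (hv i) trivial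

instance isPrecomplete_pi {ι : Type*} [Finite ι] [IsPrecomplete I S] :
    IsPrecomplete I (ι → S) := by
  refine ⟨fun f hf ↦ ?_⟩
  have h (i : ι) : ∃ L : S, ∀ n, f n i ≡ L [SMOD (I ^ n • ⊤ : Submodule S S)] := by
    refine IsPrecomplete.prec ‹_› (f := fun n ↦ f n i) fun {m n} hmn ↦ ?_
    have := hf hmn
    rw [SModEq.sub_mem, mem_smul_top_pi_iff] at this
    rw [SModEq.sub_mem, smul_eq_mul, Ideal.mul_top]
    exact this i
  choose L hL using h
  refine ⟨L, fun n ↦ ?_⟩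
  rw [SModEq.sub_mem, mem_smul_top_pi_iff]
  intro i
  have := hL i n
  rwa [SModEq.sub_mem, smul_eq_mul, Ideal.mul_top] at this

/-- Nakayama's lemma for Hausdorff modules over a complete ring: no finiteness of the ambient
module is required. -/
theorem Submodule.le_of_le_sup_smul_of_isPrecomplete [IsPrecomplete I S]
    {M : Type*} [AddCommGroup M] [Module S M] [IsHausdorff I M] {N N' : Submodule S M}
    (hN : N.FG) (hNN' : N ≤ N') (h : N' ≤ N ⊔ I • N') : N' ≤ N := by
  obtain ⟨n, s, hs⟩ := Submodule.fg_iff_exists_fin_generating_family.1 hN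
  have hsN : ∀ i, s i ∈ N' := fun i ↦ hNN' (hs ▸ Submodule.subset_span ⟨i, rfl⟩)
  let f : (Fin n → S) →ₗ[S] N' := Fintype.linearCombination S (fun i ↦ (⟨s i, hsN i⟩ : N'))
  have hf : ∀ v, ((f v : N') : M) = Fintype.linearCombination S s v := by
    intro v
    simp [f, Fintype.linearCombination_apply]
  have hr : LinearMap.range (Fintype.linearCombination S s) = N := by
    rw [Fintype.range_linearCombination, hs]
  have := isHausdorff_of_injective I N'.subtype N'.injective_subtype
  have hsurj : Function.Surjective f := by
    apply surjective_of_mkQ_comp_surjective (I := I)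
    intro z
    obtain ⟨x, rfl⟩ := Submodule.mkQ_surjective _ z
    obtain ⟨a, ha, b, hb, hab⟩ := Submodule.mem_sup.1 (h x.2)
    rw [← hr] at ha
    obtain ⟨v, rfl⟩ := ha
    refine ⟨v, ?_⟩
    rw [LinearMap.comp_apply, ← sub_eq_zero, ← map_sub, Submodule.mkQ_apply,
      Submodule.Quotient.mk_eq_zero, ← neg_mem_iff, neg_sub]
    have hb' : b ∈ Submodule.map N'.subtype (I • ⊤) := by
      rwa [Submodule.map_smul'', Submodule.map_subtype_top]
    obtain ⟨c, hc, hcb⟩ := hb'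
    have hcx : x - f v = c := by
      apply Subtype.ext
      rw [Submodule.coe_sub, hf, ← hab]
      simp only [Submodule.subtype_apply] at hcb
      rw [hcb, add_sub_cancel_left]
    rw [hcx]
    exact hc
  intro x hx
  obtain ⟨v, hv⟩ := hsurj ⟨x, hx⟩
  rw [← hr]
  exact ⟨v, by rw [← hf, hv]⟩

/-- Cohen: a complete local ring whose maximal ideal is finitely generated is noetherian. -/
theorem isNoetherianRing_of_isAdicComplete [IsLocalRing S]
    [IsAdicComplete (IsLocalRing.maximalIdeal S) S] (hfg : (IsLocalRing.maximalIdeal S).FG) :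
    IsNoetherianRing S := by
  by_contra hS
  have hne : ∃ J : Ideal S, ¬ J.FG := by
    by_contra! h
    exact hS ⟨h⟩
  obtain ⟨J₀, hJ₀⟩ := hne
  obtain ⟨P, -, hP⟩ := zorn_le_nonempty₀ {J : Ideal S | ¬ J.FG} (fun C hC hCc J hJ ↦ by
    refine ⟨sSup C, fun hfg ↦ ?_, fun K hK ↦ le_sSup hK⟩
    obtain ⟨G, hG⟩ := hfg
    obtain ⟨K, hKC, hGK⟩ : ∃ K ∈ C, (G : Set S) ⊆ K := by
      refine hCc.directedOn.exists_mem_subset_of_finset_subset_biUnion ⟨J, hJ⟩ (fun _ hx ↦ ?_)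
      simp only [Set.mem_iUnion, SetLike.mem_coe, exists_prop]
      exact (Submodule.mem_sSup_of_directed ⟨J, hJ⟩ hCc.directedOn).1
        (hG ▸ Submodule.subset_span hx)
    have : K = sSup C := le_antisymm (le_sSup hKC) (hG ▸ Submodule.span_le.2 hGK)
    exact hC hKC (this ▸ ⟨G, hG⟩)) J₀ hJ₀
  have hprime : P.IsPrime := Ideal.isOka_fg.isPrime_of_maximal_not hP
  by_cases hm : IsLocalRing.maximalIdeal S ≤ P
  · rw [← (IsLocalRing.maximalIdeal.isMaximal S).eq_of_le hprime.ne_top hm] at hP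
    exact hP.1 hfg
  · obtain ⟨y, hy, hyP⟩ := SetLike.not_le_iff_exists.1 hm
    have hyfg : (P ⊔ Ideal.span {y}).FG := by
      by_contra h
      exact hyP (hP.2 h le_sup_left (Ideal.mem_sup_right (Ideal.mem_span_singleton_self y)))
    obtain ⟨n, f, hf⟩ := Submodule.fg_iff_exists_fin_generating_family.1 hyfg
    have H : ∀ k, ∃ p ∈ P, ∃ r, p + r * y = f k := by
      intro k
      have hk : f k ∈ P ⊔ Ideal.span {y} := hf ▸ Submodule.subset_span ⟨k, rfl⟩
      obtain ⟨p, hp, q, hq, h⟩ := Submodule.mem_sup.1 hk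
      obtain ⟨r, rfl⟩ := Ideal.mem_span_singleton'.1 hq
      exact ⟨p, hp, r, h⟩
    choose p hp r hr using H
    have hle : Ideal.span (Set.range p) ≤ P :=
      Ideal.span_le.2 (by rintro _ ⟨k, rfl⟩; exact hp k)
    have hPfg : (Ideal.span (Set.range p)).FG := ⟨(Set.finite_range p).toFinset, by simp⟩
    have hle' : P ⊔ Ideal.span {y} ≤ Ideal.span (Set.range p) ⊔ Ideal.span {y} := by
      rw [← hf, Submodule.span_le]
      rintro _ ⟨k, rfl⟩
      rw [← hr k]
      exact add_mem (Ideal.mem_sup_left (Ideal.subset_span ⟨k, rfl⟩))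
        (Ideal.mem_sup_right (Ideal.mul_mem_left _ _ (Ideal.mem_span_singleton_self y)))
    have key : P ≤ Ideal.span (Set.range p) ⊔ IsLocalRing.maximalIdeal S • P := by
      intro x hx
      obtain ⟨a, ha, b, hb, h⟩ := Submodule.mem_sup.1 (hle' (Ideal.mem_sup_left hx))
      obtain ⟨s, rfl⟩ := Ideal.mem_span_singleton'.1 hb
      have hsy : s * y ∈ P := by
        rw [← add_sub_cancel_left a (s * y), h]
        exact sub_mem hx (hle ha)
      have hs : s ∈ P := (hprime.mem_or_mem hsy).resolve_right hyP
      rw [← h, mul_comm s y]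
      exact add_mem (Ideal.mem_sup_left ha) (Ideal.mem_sup_right (Ideal.mul_mem_mul hy hs))
    have := Submodule.le_of_le_sup_smul_of_isPrecomplete (IsLocalRing.maximalIdeal S) hPfg hle key
    exact hP.1 (le_antisymm hle this ▸ hPfg)

end Complete

theorem exists_completion (L : Type) [CommRing L] [IsNoetherianRing L] [IsLocalRing L] :
    ∃ (S : Type) (_ : CommRing S) (_ : Algebra L S) (_ : IsNoetherianRing S)
      (_ : IsLocalRing S), Module.Flat L S ∧ IsLocalHom (algebraMap L S) ∧
      IsAdicComplete (IsLocalRing.maximalIdeal S) S ∧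
      IsLocalRing.maximalIdeal S = (IsLocalRing.maximalIdeal L).map (algebraMap L S) := by
  refine ⟨AdicCompletion (IsLocalRing.maximalIdeal L) L, inferInstance, inferInstance,
    ?_, inferInstance, AdicCompletion.flat_of_isNoetherian _, inferInstance, inferInstance,
    AdicCompletion.maximalIdeal_eq_map⟩
  apply isNoetherianRing_of_isAdicComplete
  rw [AdicCompletion.maximalIdeal_eq_map]
  exact Ideal.FG.map (IsNoetherian.noetherian _) _

/-- The completion of the localization of a noetherian ring at a prime. -/
theorem exists_flat_isAdicComplete (Q : Type) [CommRing Q] [IsNoetherianRing Q] (q : Ideal Q)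
    [q.IsPrime] : ∃ (S : Type) (_ : CommRing S) (_ : Algebra Q S) (_ : IsNoetherianRing S)
      (_ : IsLocalRing S), Module.Flat Q S ∧
      IsAdicComplete (IsLocalRing.maximalIdeal S) S ∧
      IsLocalRing.maximalIdeal S = q.map (algebraMap Q S) ∧
      (IsLocalRing.maximalIdeal S).comap (algebraMap Q S) = q := by
  have : IsNoetherianRing (Localization.AtPrime q) :=
    IsLocalization.isNoetherianRing q.primeCompl _ ‹_›
  obtain ⟨S, _, _, _, _, hflat, hloc, hcomp, hmax⟩ :=
    exists_completion (Localization.AtPrime q)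
  let _ : Algebra Q S :=
    ((algebraMap (Localization.AtPrime q) S).comp
      (algebraMap Q (Localization.AtPrime q))).toAlgebra
  have : IsScalarTower Q (Localization.AtPrime q) S := IsScalarTower.of_algebraMap_eq' rfl
  refine ⟨S, inferInstance, inferInstance, inferInstance, inferInstance,
    Module.Flat.trans Q (Localization.AtPrime q) S, hcomp, ?_, ?_⟩
  · rw [hmax, ← Localization.AtPrime.map_eq_maximalIdeal, Ideal.map_map]
    rfl
  · have h : (IsLocalRing.maximalIdeal S).comap (algebraMap (Localization.AtPrime q) S) =
        IsLocalRing.maximalIdeal (Localization.AtPrime q) :=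
      ((IsLocalRing.local_hom_TFAE (algebraMap (Localization.AtPrime q) S)).out 0 4).1 hloc
    rw [IsScalarTower.algebraMap_eq Q (Localization.AtPrime q) S, ← Ideal.comap_comap, h]
    exact Localization.AtPrime.under_maximalIdeal

end

section

section Hull

variable (R : Type) [CommRing R]

theorem exists_injective_extension (N : Type) [AddCommGroup N] [Module R N] :
    ∃ (B : Type) (_ : AddCommGroup B) (_ : Module R B) (f : N →ₗ[R] B),
      Module.Injective R B ∧ Function.Injective f := by
  let B : ModuleCat R := Injective.under (ModuleCat.of R N)
  have hB : Injective B := inferInstanceAs (Injective (Injective.under (ModuleCat.of R N)))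
  have : Injective (ModuleCat.of R B) := hB
  exact ⟨B, inferInstance, inferInstance, (Injective.ι (ModuleCat.of R N)).hom,
    Module.injective_module_of_injective_object R B,
    (ModuleCat.mono_iff_injective _).1 inferInstance⟩

/-- The injective hull `E` of the residue field of a local ring, with a generator `e₀` of its
socle. -/
theorem exists_injectiveHull [IsLocalRing R] :
    ∃ (E : Type) (_ : AddCommGroup E) (_ : Module R E) (e₀ : E),
      Module.Injective R E ∧ e₀ ≠ 0 ∧ (∀ r ∈ IsLocalRing.maximalIdeal R, r • e₀ = 0) ∧
      ∀ y : E, y ≠ 0 → ∃ r : R, r • y = e₀ := by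
  obtain ⟨B, _, _, f, hB, hf⟩ := exists_injective_extension R (R ⧸ IsLocalRing.maximalIdeal R)
  obtain ⟨b, hb0, hbm⟩ : ∃ b : B, b ≠ 0 ∧ ∀ r ∈ IsLocalRing.maximalIdeal R, r • b = 0 := by
    refine ⟨f 1, fun h => one_ne_zero (hf (h.trans f.map_zero.symm)), fun r hr => ?_⟩
    rw [← f.map_smul, ← f.map_zero]
    congr 1
    rw [Algebra.smul_def, mul_one]
    exact Ideal.Quotient.eq_zero_iff_mem.2 hr
  let T : Set (Submodule R B) := {P | b ∈ P ∧ ∀ y ∈ P, y ≠ 0 → ∃ r : R, r • y = b}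
  have hT : R ∙ b ∈ T := by
    refine ⟨Submodule.mem_span_singleton_self b, fun y hy hy0 => ?_⟩
    obtain ⟨a, rfl⟩ := Submodule.mem_span_singleton.1 hy
    have ha : IsUnit a := by
      by_contra h
      exact hy0 (hbm a ((IsLocalRing.mem_maximalIdeal a).2 h))
    obtain ⟨u, rfl⟩ := ha
    exact ⟨↑u⁻¹, by rw [smul_smul, Units.inv_mul, one_smul]⟩
  obtain ⟨E, -, hE, hEmax⟩ := zorn_le_nonempty₀ T (fun c hc hchain y hy => by
    refine ⟨sSup c, ⟨?_, fun z hz hz0 => ?_⟩, fun z hz => le_sSup hz⟩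
    · exact (le_sSup hy : y ≤ sSup c) (hc hy).1
    · obtain ⟨P, hP, hzP⟩ := (Submodule.mem_sSup_of_directed ⟨y, hy⟩ hchain.directedOn).1 hz
      exact (hc hP).2 z hzP hz0) (R ∙ b) hT
  obtain ⟨N, -, hN, hNmax⟩ := zorn_le_nonempty₀ {P : Submodule R B | b ∉ P}
    (fun c hc hchain y hy => by
      refine ⟨sSup c, fun h => ?_, fun z hz => le_sSup hz⟩
      obtain ⟨P, hP, hbP⟩ := (Submodule.mem_sSup_of_directed ⟨y, hy⟩ hchain.directedOn).1 h
      exact hc hP hbP) ⊥ (by simpa using hb0)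
  have hN' : b ∉ N := hN
  have hess : ∀ y : B ⧸ N, y ≠ 0 → ∃ r : R, r • y = N.mkQ b := by
    intro y hy
    obtain ⟨y, rfl⟩ := N.mkQ_surjective y
    have hyN : y ∉ N := fun h => hy ((Submodule.Quotient.mk_eq_zero N).2 h)
    have hmem : b ∈ N ⊔ R ∙ y := by
      by_contra h
      exact hyN (hNmax (y := N ⊔ R ∙ y) h le_sup_left
        (Submodule.mem_sup_right (Submodule.mem_span_singleton_self y)))
    obtain ⟨n, hn, z, hz, hnz⟩ := Submodule.mem_sup.1 hmem
    obtain ⟨r, rfl⟩ := Submodule.mem_span_singleton.1 hz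
    refine ⟨r, ?_⟩
    rw [← hnz, map_add, map_smul, Submodule.mkQ_apply N n, (Submodule.Quotient.mk_eq_zero N).2 hn,
      zero_add]
  have hinj : Function.Injective (N.mkQ ∘ₗ E.subtype) := by
    rw [injective_iff_map_eq_zero]
    intro y hy
    by_contra hy0
    obtain ⟨r, hr⟩ := hE.2 y y.2 (fun h => hy0 (Subtype.ext h))
    exact hN' (hr ▸ N.smul_mem r ((Submodule.Quotient.mk_eq_zero N).1 hy))
  obtain ⟨g, hg⟩ := hB.out (N.mkQ ∘ₗ E.subtype) hinj E.subtype
  have hg' : ∀ e ∈ E, g (N.mkQ e) = e := fun e he => hg ⟨e, he⟩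
  have hrange : LinearMap.range g ≤ E := by
    refine hEmax (y := LinearMap.range g) ⟨⟨N.mkQ b, hg' b hE.1⟩, ?_⟩
      (fun e he => ⟨N.mkQ e, hg' e he⟩)
    rintro _ ⟨z, rfl⟩ hz
    obtain ⟨r, hr⟩ := hess z (fun h => hz (by rw [h, map_zero]))
    exact ⟨r, by rw [← map_smul, hr, hg' b hE.1]⟩
  refine ⟨E, inferInstance, inferInstance, ⟨b, hE.1⟩, ⟨fun X Y _ _ _ _ i hi k => ?_⟩,
    fun h => hb0 (congrArg Subtype.val h), fun r hr => Subtype.ext (hbm r hr), fun y hy => ?_⟩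
  · obtain ⟨h, hh⟩ := hB.out i hi (E.subtype ∘ₗ k)
    refine ⟨LinearMap.codRestrict E (g ∘ₗ N.mkQ ∘ₗ h) (fun z => hrange ⟨_, rfl⟩), fun x => ?_⟩
    apply Subtype.ext
    change g (N.mkQ (h (i x))) = k x
    rw [hh x]
    exact hg' _ (k x).2
  · obtain ⟨r, hr⟩ := hE.2 y y.2 (fun h => hy (Subtype.ext h))
    exact ⟨r, Subtype.ext hr⟩

variable {R}

theorem exists_pow_smul_eq_zero [IsLocalRing R] [IsNoetherianRing R] {E : Type} [AddCommGroup E]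
    [Module R E] {e₀ : E} (h0 : e₀ ≠ 0) (h : ∀ y : E, y ≠ 0 → ∃ r : R, r • y = e₀) (e : E) :
    ∃ n : ℕ, ∀ r ∈ IsLocalRing.maximalIdeal R ^ n, r • e = 0 := by
  by_contra! hcon
  have hmem : ∀ n : ℕ, ∃ r ∈ IsLocalRing.maximalIdeal R ^ n, r • e = e₀ := by
    intro n
    obtain ⟨r, hr, hre⟩ := hcon n
    obtain ⟨s, hs⟩ := h _ hre
    exact ⟨s * r, Ideal.mul_mem_left _ _ hr, by rw [mul_smul, hs]⟩
  obtain ⟨r₀, -, hr₀⟩ := hmem 0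
  have : IsHausdorff (IsLocalRing.maximalIdeal R) (R ∙ e) := inferInstance
  have hz := this.haus ⟨e₀, Submodule.mem_span_singleton.2 ⟨r₀, hr₀⟩⟩ (fun n => by
    rw [SModEq.zero]
    obtain ⟨r, hr, hre⟩ := hmem n
    have : (⟨e₀, Submodule.mem_span_singleton.2 ⟨r₀, hr₀⟩⟩ : R ∙ e) =
        r • ⟨e, Submodule.mem_span_singleton_self e⟩ := Subtype.ext hre.symm
    rw [this]
    exact Submodule.smul_mem_smul hr trivial)
  exact h0 (congrArg Subtype.val hz)

end Hull

end

section

open IsLocalRing TensorProduct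

theorem Module.Injective.exists_comp_eq {R : Type} [CommRing R] {I X Y : Type} [AddCommGroup I]
    [Module R I] [hI : Module.Injective R I] [AddCommGroup X] [Module R X] [AddCommGroup Y]
    [Module R Y] (A : X →ₗ[R] Y) (f : X →ₗ[R] I) (h : LinearMap.ker A ≤ LinearMap.ker f) :
    ∃ g : Y →ₗ[R] I, g ∘ₗ A = f := by
  obtain ⟨g, hg⟩ := hI.out ((LinearMap.ker A).liftQ A le_rfl)
    (by rw [← LinearMap.ker_eq_bot, Submodule.ker_liftQ_eq_bot]; exact le_rfl)
    ((LinearMap.ker A).liftQ f h)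
  exact ⟨g, LinearMap.ext fun x => hg ((LinearMap.ker A).mkQ x)⟩

theorem Module.Injective.of_flat_restrictScalars {R R₁ : Type} [CommRing R] [CommRing R₁]
    [Algebra R R₁] [Module.Flat R R₁] {I : Type} [AddCommGroup I] [Module R I] [Module R₁ I]
    [IsScalarTower R R₁ I] [hI : Module.Injective R₁ I] : Module.Injective R I := by
  refine ⟨fun X Y _ _ _ _ f hf g => ?_⟩
  obtain ⟨h, hh⟩ := hI.out (f.baseChange R₁)
    (Module.Flat.lTensor_preserves_injective_linearMap (M := R₁) f hf)
    (TensorProduct.AlgebraTensorModule.lift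
      ((LinearMap.toSpanSingleton R₁ (X →ₗ[R] I) g)))
  refine ⟨(h.restrictScalars R) ∘ₗ TensorProduct.mk R R₁ Y 1, fun x => ?_⟩
  have := hh (1 ⊗ₜ x)
  simpa using this

theorem isPrecomplete_map_of_surjective {A B : Type} [CommRing A] [CommRing B] (φ : A →+* B)
    (hφ : Function.Surjective φ) (I : Ideal A) [IsPrecomplete I A] :
    IsPrecomplete (I.map φ) B := by
  refine ⟨fun f hf => ?_⟩
  have hd : ∀ n, ∃ a ∈ I ^ n, φ a = f (n + 1) - f n := by
    intro n
    have h := (SModEq.sub_mem.1 (hf n.le_succ).symm)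
    rw [smul_eq_mul, Ideal.mul_top, ← Ideal.map_pow] at h
    exact (Ideal.mem_map_iff_of_surjective φ hφ).1 h
  choose a ha hφa using hd
  obtain ⟨a₀, ha₀⟩ := hφ (f 0)
  let s : ℕ → A := fun n => a₀ + ∑ i ∈ Finset.range n, a i
  have hs : ∀ n, φ (s n) = f n := by
    intro n
    simp only [s, map_add, map_sum, hφa, ha₀, Finset.sum_range_sub]
    abel
  obtain ⟨L, hL⟩ := IsPrecomplete.prec (I := I) (M := A) inferInstance (f := s) (by
    intro m n hmn
    induction n, hmn using Nat.le_induction with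
    | base => rfl
    | succ n hmn ih =>
      refine ih.trans (SModEq.sub_mem.2 ?_)
      have : s n - s (n + 1) = - a n := by simp [s, Finset.sum_range_succ]
      rw [this, smul_eq_mul, Ideal.mul_top]
      exact neg_mem (Ideal.pow_le_pow_right hmn (ha n)))
  refine ⟨φ L, fun n => SModEq.sub_mem.2 ?_⟩
  have h := SModEq.sub_mem.1 (hL n)
  rw [smul_eq_mul, Ideal.mul_top] at h ⊢
  rw [← hs, ← map_sub, ← Ideal.map_pow]
  exact Ideal.mem_map_of_mem φ h

section Length

variable {A : Type} [CommRing A] [IsLocalRing A] {I : Type} [AddCommGroup I] [Module A I]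

theorem length_linearMap_le_of_isSimpleModule {i₀ : I} (h0 : i₀ ≠ 0)
    (hi₀ : ∀ r ∈ maximalIdeal A, r • i₀ = 0)
    (h : ∀ y : I, y ≠ 0 → ∃ r : A, r • y = i₀) (S : Type) [AddCommGroup S] [Module A S]
    [IsSimpleModule A S] : Module.length A (S →ₗ[A] I) ≤ Module.length A S := by
  obtain ⟨P, hP, ⟨e⟩⟩ := isSimpleModule_iff_quot_maximal.mp ‹IsSimpleModule A S›
  obtain rfl := eq_maximalIdeal hP
  have hk : ∀ r ∈ maximalIdeal A, ∀ s : S, r • s = 0 := by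
    intro r hr s
    apply e.injective
    rw [map_smul, map_zero]
    obtain ⟨a, ha⟩ := Ideal.Quotient.mk_surjective (e s)
    rw [← ha, ← Ideal.Quotient.mk_eq_mk, ← Submodule.Quotient.mk_smul,
      Submodule.Quotient.mk_eq_zero, smul_eq_mul]
    exact Ideal.mul_mem_right _ _ hr
  let g : (A ⧸ maximalIdeal A) →ₗ[A] I := (maximalIdeal A).liftQ (LinearMap.toSpanSingleton A I i₀)
    (fun r hr => by simpa using hi₀ r hr)
  have hg : ∀ y : I, (∀ r ∈ maximalIdeal A, r • y = 0) → y ∈ LinearMap.range g := by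
    intro y hy
    by_cases hy0 : y = 0
    · exact hy0 ▸ zero_mem _
    obtain ⟨r, hr⟩ := h y hy0
    have hru : IsUnit r := by
      by_contra hr'
      exact h0 (by rw [← hr, hy r ((mem_maximalIdeal r).2 hr')])
    obtain ⟨u, rfl⟩ := hru
    refine ⟨Submodule.Quotient.mk (↑u⁻¹ : A), ?_⟩
    rw [Submodule.liftQ_apply, LinearMap.toSpanSingleton_apply, ← hr, smul_smul,
      Units.inv_mul, one_smul]
  have := IsSimpleModule.nontrivial A S
  obtain ⟨s, hs⟩ := exists_ne (0 : S)
  have hinj : Function.Injective (LinearMap.codRestrict (LinearMap.range g)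
      (LinearMap.applyₗ s : (S →ₗ[A] I) →ₗ[A] I)
      (fun f => hg _ fun r hr => by simp [← map_smul, hk r hr])) := by
    rw [injective_iff_map_eq_zero]
    intro f hf
    have hf : f s = 0 := congrArg Subtype.val hf
    ext t
    obtain ⟨r, rfl⟩ := IsSimpleModule.toSpanSingleton_surjective A hs t
    simp [hf]
  exact (Module.length_le_of_injective _ hinj).trans
    ((Module.length_le_of_surjective _ (LinearMap.surjective_rangeRestrict g)).trans
      e.length_eq.ge)

/-- The length of the dual into a module with simple essential socle is at most the length. -/
theorem length_linearMap_le {i₀ : I} (h0 : i₀ ≠ 0)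
    (hi₀ : ∀ r ∈ maximalIdeal A, r • i₀ = 0)
    (h : ∀ y : I, y ≠ 0 → ∃ r : A, r • y = i₀) (N : Type) [AddCommGroup N] [Module A N]
    (hN : IsFiniteLength A N) : Module.length A (N →ₗ[A] I) ≤ Module.length A N := by
  induction hN with
  | of_subsingleton =>
    rw [Module.length_eq_zero]
    exact bot_le
  | @of_simple_quotient N _ _ P hP hPfin ih =>
    have h2 := Module.length_eq_add_of_exact (LinearMap.lcomp A I P.mkQ)
      (LinearMap.lcomp A I P.subtype).rangeRestrict
      (fun f g hfg => LinearMap.ext fun x => by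
        obtain ⟨x, rfl⟩ := P.mkQ_surjective x
        exact LinearMap.congr_fun hfg x)
      (LinearMap.surjective_rangeRestrict _)
      (by
        rw [LinearMap.exact_iff, LinearMap.ker_rangeRestrict]
        exact LinearMap.exact_iff.1 (LinearMap.exact_lcomp_of_exact_of_surjective _
          (LinearMap.exact_subtype_mkQ P) P.mkQ_surjective))
    have h1 := Module.length_eq_add_of_exact P.subtype P.mkQ P.injective_subtype
      P.mkQ_surjective (LinearMap.exact_subtype_mkQ P)
    rw [h2, h1, add_comm]
    gcongr
    · exact (Module.length_le_of_injective (LinearMap.range _).subtype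
        Subtype.val_injective).trans ih
    · exact length_linearMap_le_of_isSimpleModule h0 hi₀ h _

theorem LinearMap.surjective_of_injective_of_length_le {A M N : Type} [CommRing A]
    [AddCommGroup M] [Module A M] [AddCommGroup N] [Module A N] (f : M →ₗ[A] N)
    (hf : Function.Injective f) (hM : IsFiniteLength A M)
    (h : Module.length A N ≤ Module.length A M) : Function.Surjective f := by
  have h1 := Module.length_eq_add_of_exact f (LinearMap.range f).mkQ hf
    (Submodule.mkQ_surjective _) (LinearMap.exact_map_mkQ_range f)
  rw [← LinearMap.range_eq_top, ← Submodule.Quotient.subsingleton_iff,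
    ← Module.length_eq_zero_iff (R := A)]
  rw [h1] at h
  exact le_bot_iff.1 ((ENat.add_le_add_iff_left (Module.length_ne_top_iff.2 hM)).1
    (h.trans_eq (add_zero _).symm))

end Length

end

section

open IsLocalRing TensorProduct

section Dual

variable {R : Type} [CommRing R] {E I : Type} [AddCommGroup E] [Module R E] [AddCommGroup I]
  [Module R I] [Module.Injective R I]

theorem exists_sum_eq_of_ker_le {l : Type} [Fintype l] [DecidableEq l] (y : l → R) (f : E →ₗ[R] I)
    (h : ∀ e, (∀ i, y i • e = 0) → f e = 0) :
    ∃ g : l → (E →ₗ[R] I), f = ∑ i, y i • g i := by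
  obtain ⟨g, hg⟩ := Module.Injective.exists_comp_eq
    (LinearMap.pi fun i => y i • (LinearMap.id : E →ₗ[R] E)) f
    (fun e he => h e fun i => congrFun he i)
  refine ⟨fun i => g ∘ₗ LinearMap.single R (fun _ => E) i, LinearMap.ext fun e => ?_⟩
  rw [← hg]
  simp only [LinearMap.comp_apply, LinearMap.sum_apply, LinearMap.smul_apply, ← map_smul, ← map_sum]
  congr 1
  ext j
  simp [Finset.sum_apply, Pi.single_apply]

/-- Over a noetherian ring, maps between injective modules form a flat module. -/
theorem flat_linearMap_of_injective [IsNoetherianRing R] [Module.Injective R E] :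
    Module.Flat R (E →ₗ[R] I) := by
  classical
  rw [Module.Flat.iff_forall_isTrivialRelation]
  intro l r f hrf
  let ρ : (Fin l → R) →ₗ[R] R := Fintype.linearCombination R r
  obtain ⟨t, a, ha⟩ := Submodule.fg_iff_exists_fin_generating_family.1
    (IsNoetherian.noetherian (LinearMap.ker ρ))
  have haρ : ∀ j, ρ (a j) = 0 := fun j => by
    have : a j ∈ LinearMap.ker ρ := ha ▸ Submodule.subset_span ⟨j, rfl⟩
    exact this
  let F : (Fin l → E) →ₗ[R] I := LinearMap.lsum R (fun _ => E) ℕ f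
  let A : (Fin l → E) →ₗ[R] (Fin t → E) :=
    LinearMap.pi fun j => ∑ i, a j i • LinearMap.proj i
  obtain ⟨h, hh⟩ := Module.Injective.exists_comp_eq A F (fun e he => by
    have he : ∀ j, ∑ i, a j i • e i = 0 := fun j => by
      simpa [A] using congrFun he j
    obtain ⟨k, hk⟩ := Module.Injective.exists_comp_eq ρ (Fintype.linearCombination R e)
      (by
        rw [← ha, Submodule.span_le]
        rintro _ ⟨j, rfl⟩
        simpa [Fintype.linearCombination_apply] using he j)
    have hek : ∀ i, e i = r i • k 1 := fun i => by
      have := LinearMap.congr_fun hk (Pi.single i 1)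
      simpa [ρ, Fintype.linearCombination_apply, Pi.single_apply, ← map_smul] using this.symm
    have h0 := LinearMap.congr_fun hrf (k 1)
    simp only [LinearMap.sum_apply, LinearMap.smul_apply, ← map_smul, ← hek] at h0
    simpa [F] using h0)
  refine ⟨t, fun i j => a j i, fun j => h ∘ₗ LinearMap.single R (fun _ => E) j, fun i => ?_,
    fun j => ?_⟩
  · ext e
    have h1 := LinearMap.congr_fun hh (Pi.single i e)
    have h2 : F (Pi.single i e) = f i e := by
      simp [F, Pi.single_apply, apply_ite]
    rw [← h2, ← h1]
    simp only [LinearMap.comp_apply, LinearMap.sum_apply, LinearMap.smul_apply, ← map_smul,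
      ← map_sum]
    congr 1
    ext j
    simp [A, Finset.sum_apply, Pi.single_apply]
  · have := haρ j
    simpa [ρ, Fintype.linearCombination_apply, mul_comm] using this

end Dual

section Evaluation

variable {R : Type} [CommRing R] [IsLocalRing R] {E I : Type} [AddCommGroup E] [Module R E]
  [AddCommGroup I] [Module R I] [Module.Injective R I] {e₀ : E}

theorem exists_linearMap_apply_eq (h0 : e₀ ≠ 0)
    {i : I} (hi : ∀ r ∈ maximalIdeal R, r • i = 0) : ∃ f : E →ₗ[R] I, f e₀ = i := by
  obtain ⟨f, hf⟩ := Module.Injective.exists_comp_eq (LinearMap.toSpanSingleton R E e₀)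
    (LinearMap.toSpanSingleton R I i) (fun r hr => by
      have hr : r • e₀ = 0 := hr
      refine hi r ((mem_maximalIdeal r).2 fun hu => h0 ?_)
      obtain ⟨u, rfl⟩ := hu
      rw [← one_smul R e₀, ← u.inv_mul, mul_smul, hr, smul_zero])
  exact ⟨f, by simpa using LinearMap.congr_fun hf 1⟩

/-- A map vanishing on the socle lies in `𝔪 Hom(E, I)`. -/
theorem mem_maximalIdeal_smul_top_of_apply_eq_zero [IsNoetherianRing R]
    (h0 : e₀ ≠ 0) (h : ∀ y : E, y ≠ 0 → ∃ r : R, r • y = e₀)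
    (f : E →ₗ[R] I) (hf : f e₀ = 0) :
    f ∈ maximalIdeal R • (⊤ : Submodule R (E →ₗ[R] I)) := by
  classical
  obtain ⟨t, y, hy⟩ := Submodule.fg_iff_exists_fin_generating_family.1
    (IsNoetherian.noetherian (maximalIdeal R))
  obtain ⟨g, rfl⟩ := exists_sum_eq_of_ker_le y f (fun e he => by
    by_cases he0 : e = 0
    · rw [he0, map_zero]
    obtain ⟨r, hr⟩ := h e he0
    have hm : maximalIdeal R ≤ LinearMap.ker (LinearMap.toSpanSingleton R E e) := by
      rw [← hy, Submodule.span_le]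
      rintro _ ⟨i, rfl⟩
      exact he i
    obtain ⟨u, rfl⟩ : IsUnit r := by
      by_contra hru
      exact h0 (hr.symm.trans (hm ((mem_maximalIdeal r).2 hru)))
    rw [← one_smul R e, ← u.inv_mul, mul_smul, hr, map_smul, hf, smul_zero])
  exact sum_mem fun i _ => Submodule.smul_mem_smul (hy ▸ Submodule.subset_span ⟨i, rfl⟩) trivial

end Evaluation

end

section

open IsLocalRing TensorProduct

section DualModule

/-- Evaluation of linear maps at `e₀`, linear over the ring acting on the target. -/
def evalAt (R R₁ : Type) [CommRing R] [CommRing R₁] [Algebra R R₁] (I : Type) [AddCommGroup I]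
    [Module R I] [Module R₁ I] [IsScalarTower R R₁ I] {E : Type} [AddCommGroup E] [Module R E]
    (e₀ : E) : (E →ₗ[R] I) →ₗ[R₁] I where
  toFun f := f e₀
  map_add' _ _ := rfl
  map_smul' _ _ := rfl

variable {R R₁ : Type} [CommRing R] [IsLocalRing R] [CommRing R₁]
  [IsLocalRing R₁] [Algebra R R₁]
  {E I : Type} [AddCommGroup E] [Module R E]
  [AddCommGroup I] [Module R I] [Module R₁ I] [IsScalarTower R R₁ I]
  {e₀ : E} {i₀ : I}

theorem isHausdorff_linearMap (he : ∀ e : E, ∃ n : ℕ, ∀ r ∈ maximalIdeal R ^ n, r • e = 0)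
    {c : ℕ} (hc : maximalIdeal R₁ ^ c ≤ (maximalIdeal R).map (algebraMap R R₁)) :
    IsHausdorff (maximalIdeal R₁) (E →ₗ[R] I) := by
  refine ⟨fun f hf => LinearMap.ext fun e => ?_⟩
  obtain ⟨n, hn⟩ := he e
  have h1 := SModEq.zero.1 (hf (c * n))
  have h2 : maximalIdeal R₁ ^ (c * n) ≤ (maximalIdeal R ^ n).map (algebraMap R R₁) := by
    rw [pow_mul, Ideal.map_pow]
    exact Ideal.pow_right_mono hc n
  have h3 : maximalIdeal R₁ ^ (c * n) • (⊤ : Submodule R₁ (E →ₗ[R] I)) ≤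
      LinearMap.ker (evalAt R R₁ I e) := by
    refine (Submodule.smul_mono_left h2).trans (Submodule.smul_le.2 fun a ha g _ => ?_)
    induction ha using Submodule.span_induction with
    | mem a ha =>
      obtain ⟨r, hr, rfl⟩ := ha
      rw [algebraMap_smul, LinearMap.mem_ker]
      change r • g e = 0
      rw [← map_smul,
        hn r hr, map_zero]
    | zero => rw [zero_smul]; exact zero_mem _
    | add a b _ _ ha hb => rw [add_smul]; exact add_mem ha hb
    | smul b a _ ha => rw [smul_assoc]; exact Submodule.smul_mem _ _ ha
  exact h3 h1

theorem fg_range_evalAt (hi0 : i₀ ≠ 0) (hi₀ : ∀ r ∈ maximalIdeal R₁, r • i₀ = 0)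
    (hi : ∀ y : I, y ≠ 0 → ∃ r : R₁, r • y = i₀) (he₀ : ∀ r ∈ maximalIdeal R, r • e₀ = 0)
    (hfin : IsFiniteLength R₁ (R₁ ⧸ (maximalIdeal R).map (algebraMap R R₁))) :
    (LinearMap.range (evalAt R R₁ I e₀)).FG := by
  let K := (maximalIdeal R).map (algebraMap R R₁)
  have h1 := length_linearMap_le hi0 hi₀ hi _ hfin
  have h2 : IsFiniteLength R₁ ((R₁ ⧸ K) →ₗ[R₁] I) :=
    Module.length_ne_top_iff.1 (ne_top_of_le_ne_top (Module.length_ne_top_iff.2 hfin) h1)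
  have h3 := (isFiniteLength_iff_isNoetherian_isArtinian.1 h2).1
  let ψ : ((R₁ ⧸ K) →ₗ[R₁] I) →ₗ[R₁] I := LinearMap.applyₗ (1 : R₁ ⧸ K)
  have h4 : LinearMap.range (evalAt R R₁ I e₀) ≤ LinearMap.range ψ := by
    rintro _ ⟨f, rfl⟩
    refine ⟨Submodule.liftQ K (LinearMap.toSpanSingleton R₁ I (f e₀)) ?_, ?_⟩
    · rw [Ideal.map_le_iff_le_comap]
      intro r hr
      change algebraMap R R₁ r • f e₀ = 0
      rw [algebraMap_smul, ← map_smul, he₀ r hr, map_zero]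
    · exact one_smul R₁ (f e₀)
  have : IsNoetherian R₁ (LinearMap.range ψ) :=
    isNoetherian_of_surjective ψ.rangeRestrict (LinearMap.range_rangeRestrict ψ)
  exact (isNoetherian_submodule.1 this) _ h4

theorem finite_linearMap [IsNoetherianRing R]
    [IsLocalHom (algebraMap R R₁)] [Module.Injective R I] (h0 : e₀ ≠ 0)
    (he₀ : ∀ r ∈ maximalIdeal R, r • e₀ = 0) (he : ∀ y : E, y ≠ 0 → ∃ r : R, r • y = e₀)
    (hi0 : i₀ ≠ 0) (hi₀ : ∀ r ∈ maximalIdeal R₁, r • i₀ = 0)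
    (hi : ∀ y : I, y ≠ 0 → ∃ r : R₁, r • y = i₀)
    (hfin : IsFiniteLength R₁ (R₁ ⧸ (maximalIdeal R).map (algebraMap R R₁)))
    [IsPrecomplete (maximalIdeal R₁) R₁] {c : ℕ}
    (hc : maximalIdeal R₁ ^ c ≤ (maximalIdeal R).map (algebraMap R R₁)) :
    Module.Finite R₁ (E →ₗ[R] I) := by
  obtain ⟨t, y, hy⟩ := Submodule.fg_iff_exists_fin_generating_family.1
    (fg_range_evalAt hi0 hi₀ hi he₀ hfin)
  have hy' : ∀ k, ∃ g : E →ₗ[R] I, evalAt R R₁ I e₀ g = y k := fun k => by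
    have : y k ∈ LinearMap.range (evalAt R R₁ I e₀) := hy ▸ Submodule.subset_span ⟨k, rfl⟩
    exact this
  choose g hg using hy'
  have := isHausdorff_linearMap (I := I) (exists_pow_smul_eq_zero h0 he) hc
  let N : Submodule R₁ (E →ₗ[R] I) := Submodule.span R₁ (Set.range g)
  have hN : N.FG := ⟨(Set.finite_range g).toFinset, by simp [N]⟩
  have hle : maximalIdeal R • (⊤ : Submodule R (E →ₗ[R] I)) ≤
      (maximalIdeal R₁ • (⊤ : Submodule R₁ (E →ₗ[R] I))).restrictScalars R := by
    refine Submodule.smul_le.2 fun r hr f _ => ?_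
    rw [← algebraMap_smul R₁ r f]
    have hr' : algebraMap R R₁ r ∈ maximalIdeal R₁ :=
      (mem_maximalIdeal _).2 fun hu => (mem_maximalIdeal r).1 hr (isUnit_of_map_unit _ r hu)
    exact (Submodule.restrictScalars_mem R _ _).2
      (Submodule.smul_mem_smul hr' (Submodule.mem_top (x := f)))
  have key : (⊤ : Submodule R₁ (E →ₗ[R] I)) ≤ N ⊔ maximalIdeal R₁ • ⊤ := by
    intro f _
    have h1 : evalAt R R₁ I e₀ f ∈ N.map (evalAt R R₁ I e₀) := by
      rw [Submodule.map_span, ← Set.range_comp, show _ ∘ g = y from funext hg, hy]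
      exact ⟨f, rfl⟩
    obtain ⟨d, hd, hdf⟩ := h1
    rw [← add_sub_cancel d f]
    refine Submodule.add_mem_sup hd (hle (mem_maximalIdeal_smul_top_of_apply_eq_zero h0 he _ ?_))
    change evalAt R R₁ I e₀ (f - d) = 0
    rw [map_sub, hdf, sub_self]
  have := Submodule.le_of_le_sup_smul_of_isPrecomplete (maximalIdeal R₁) hN le_top key
  exact ⟨top_le_iff.1 this ▸ hN⟩

end DualModule

/-- Maps from a first syzygy of a flat presentation into `Hom(E, I)` extend. -/
theorem exists_linearMap_extension {R R₁ E I F G : Type} [CommRing R] [CommRing R₁] [Algebra R R₁]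
    [AddCommGroup E] [Module R E] [AddCommGroup I] [Module R I] [Module R₁ I] [IsScalarTower R R₁ I]
    [hI : Module.Injective R₁ I] [AddCommGroup F] [Module R₁ F] [AddCommGroup G] [Module R₁ G]
    [Module R F] [Module R G] [IsScalarTower R R₁ F] [IsScalarTower R R₁ G] [Module.Flat R G]
    (d : F →ₗ[R₁] G) (hd : Module.Flat R (G ⧸ LinearMap.range d))
    (f : LinearMap.ker d →ₗ[R₁] (E →ₗ[R] I)) :
    ∃ g : F →ₗ[R₁] (E →ₗ[R] I), ∀ z : LinearMap.ker d, g z = f z := by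
  have h1 : Module.Flat R (LinearMap.range d) :=
    flat_of_flat_of_exact (f := (LinearMap.range d).subtype.restrictScalars R)
      (g := (LinearMap.range d).mkQ.restrictScalars R) Subtype.val_injective
      (fun x => LinearMap.exact_subtype_mkQ (LinearMap.range d) x)
      (LinearMap.range d).mkQ_surjective
  have h2 : Function.Injective (((LinearMap.ker d).subtype.restrictScalars R).rTensor E) :=
    rTensor_injective_of_flat_cokernel (g := d.rangeRestrict.restrictScalars R)
      Subtype.val_injective (by
        intro x
        change d.rangeRestrict x = 0 ↔ x ∈ Set.range Subtype.val
        rw [Subtype.range_coe, ← LinearMap.mem_ker, LinearMap.ker_rangeRestrict]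
        rfl) (LinearMap.surjective_rangeRestrict d) E
  obtain ⟨h, hh⟩ := hI.out (AlgebraTensorModule.rTensor R E (LinearMap.ker d).subtype)
    (by exact h2) (AlgebraTensorModule.lift f)
  refine ⟨AlgebraTensorModule.curry h, fun z => LinearMap.ext fun e => ?_⟩
  exact hh (z ⊗ₜ e)

end

section

open IsLocalRing

theorem isPrecomplete_of_finite {S : Type} [CommRing S] (I : Ideal S) [IsPrecomplete I S]
    (M : Type) [AddCommGroup M] [Module S M] [Module.Finite S M] : IsPrecomplete I M := by
  obtain ⟨b, π, hπ⟩ := Module.Finite.exists_fin' S M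
  refine ⟨fun f hf => ?_⟩
  have hd : ∀ n, ∃ a ∈ (I ^ n • ⊤ : Submodule S (Fin b → S)), π a = f (n + 1) - f n := by
    intro n
    have h := (SModEq.sub_mem.1 (hf n.le_succ).symm)
    rwa [← LinearMap.range_eq_top.2 hπ, LinearMap.range_eq_map, ← Submodule.map_smul''] at h
  choose a ha hπa using hd
  obtain ⟨a₀, ha₀⟩ := hπ (f 0)
  let s : ℕ → (Fin b → S) := fun n => a₀ + ∑ i ∈ Finset.range n, a i
  have hs : ∀ n, π (s n) = f n := by
    intro n
    simp only [s, map_add, map_sum, hπa, ha₀, Finset.sum_range_sub]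
    abel
  obtain ⟨L, hL⟩ := IsPrecomplete.prec (I := I) (M := Fin b → S) inferInstance (f := s) (by
    intro m n hmn
    induction n, hmn using Nat.le_induction with
    | base => rfl
    | succ n hmn ih =>
      refine ih.trans (SModEq.sub_mem.2 ?_)
      have : s n - s (n + 1) = - a n := by simp [s, Finset.sum_range_succ]
      rw [this]
      exact neg_mem (Submodule.smul_mono_left (Ideal.pow_le_pow_right hmn) (ha n)))
  refine ⟨π L, fun n => SModEq.sub_mem.2 ?_⟩
  have h := SModEq.sub_mem.1 (hL n)
  rw [← hs, ← map_sub]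
  exact (Submodule.smul_mono le_rfl le_top) (Submodule.map_smul'' (I ^ n) ⊤ π ▸
    Submodule.mem_map_of_mem h)

/-- Successive approximation in a complete module. -/
theorem exists_limit_of_step {S H : Type} [CommRing S] {I : Ideal S} [AddCommGroup H] [Module S H]
    [IsPrecomplete I H] {x : S} (hx : x ∈ I) (C : ℕ → H → Prop) (p₀ : H) (h0 : C 0 p₀)
    (hs : ∀ n p, C n p → ∃ q, C (n + 1) (p + x ^ (n + 1) • q)) :
    ∃ e : H, ∀ n, ∃ p, C n p ∧ p₀ + x • e - p ∈ (I ^ n • ⊤ : Submodule S H) := by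
  choose! q hq using hs
  let s : ℕ → H := fun n => Nat.rec (motive := fun _ => H) 0
    (fun n e => e + x ^ n • q n (p₀ + x • e)) n
  have hs : ∀ n, s (n + 1) = s n + x ^ n • q n (p₀ + x • s n) := fun n => rfl
  have hC : ∀ n, C n (p₀ + x • s n) := by
    intro n
    induction n with
    | zero => simpa [s] using h0
    | succ n ih =>
      have := hq n _ ih
      rwa [pow_succ', mul_smul, add_assoc, ← smul_add, ← hs] at this
  obtain ⟨e, he⟩ := IsPrecomplete.prec (I := I) (M := H) inferInstance (f := s) (by
    intro m n hmn
    induction n, hmn using Nat.le_induction with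
    | base => rfl
    | succ n hmn ih =>
      refine ih.trans (SModEq.sub_mem.2 ?_)
      rw [hs, sub_add_cancel_left]
      exact neg_mem (Submodule.smul_mem_smul
        (Ideal.pow_le_pow_right hmn (Ideal.pow_mem_pow hx n)) trivial))
  refine ⟨e, fun n => ⟨_, hC n, ?_⟩⟩
  rw [add_sub_add_left_eq_sub, ← smul_sub, ← neg_sub, smul_neg]
  exact neg_mem (Submodule.smul_mem _ _ (SModEq.sub_mem.1 (he n)))

theorem Module.exists_comp_eq_of_forall_mem_range {S P K N : Type} [CommRing S] [AddCommGroup P] [Module S P]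
    [Module.Projective S P] [AddCommGroup K] [Module S K] [AddCommGroup N] [Module S N]
    (g : K →ₗ[S] N) (f : P →ₗ[S] N) (h : ∀ u, f u ∈ LinearMap.range g) :
    ∃ k : P →ₗ[S] K, ∀ u, g (k u) = f u := by
  obtain ⟨k, hk⟩ := Module.projective_lifting_property g.rangeRestrict
    (f.codRestrict (LinearMap.range g) h) (LinearMap.surjective_rangeRestrict g)
  exact ⟨k, fun u => congrArg Subtype.val (LinearMap.congr_fun hk u)⟩

end

section

open IsLocalRing

section Lifting

variable {S : Type} [CommRing S] {F₀ F₁ F₂ : Type} [AddCommGroup F₀] [Module S F₀]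
  [AddCommGroup F₁] [Module S F₁] [AddCommGroup F₂] [Module S F₂]

theorem LinearMap.map_mem_smul_top (f : F₁ →ₗ[S] F₀) {J : Ideal S} {v : F₁}
    (hv : v ∈ (J • ⊤ : Submodule S F₁)) : f v ∈ (J • ⊤ : Submodule S F₀) := by
  have : f v ∈ (J • ⊤ : Submodule S F₁).map f := Submodule.mem_map_of_mem hv
  rw [Submodule.map_smul''] at this
  exact Submodule.smul_mono le_rfl le_top this

theorem Submodule.mem_sup_span_singleton_smul_top {J : Ideal S} {x : S} {v : F₁} :
    v ∈ ((J ⊔ Ideal.span {x}) • ⊤ : Submodule S F₁) ↔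
      ∃ w, v - x • w ∈ (J • ⊤ : Submodule S F₁) := by
  rw [Submodule.sup_smul, Submodule.ideal_span_singleton_smul, Submodule.mem_sup]
  constructor
  · rintro ⟨a, ha, b, hb, rfl⟩
    obtain ⟨w, -, rfl⟩ := (Submodule.mem_smul_pointwise_iff_exists _ _ _).1 hb
    exact ⟨w, by rwa [add_sub_cancel_right]⟩
  · rintro ⟨w, hw⟩
    exact ⟨_, hw, x • w, Submodule.smul_mem_pointwise_smul _ _ _ trivial, sub_add_cancel _ _⟩

/-- Modulo `J`, the maps `F₂ → F₁ → F₀` form a complex which is exact at `F₁`, and every map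
from `F₂` to the cokernel of `d₁` which is a cocycle is a coboundary. -/
structure IsExactMod (J : Ideal S) (d₁ : F₁ →ₗ[S] F₀) (d₂ : F₂ →ₗ[S] F₁) : Prop where
  comp_mem : ∀ u, d₁ (d₂ u) ∈ (J • ⊤ : Submodule S F₀)
  exact_mem : ∀ w, d₁ w ∈ (J • ⊤ : Submodule S F₀) → ∃ u, w - d₂ u ∈ (J • ⊤ : Submodule S F₁)
  lift_mem : ∀ f : F₂ →ₗ[S] F₀,
    (∀ u, d₂ u ∈ (J • ⊤ : Submodule S F₁) → f u ∈ LinearMap.range d₁ ⊔ J • ⊤) →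
    ∃ g : F₁ →ₗ[S] F₀, ∀ u, f u - g (d₂ u) ∈ LinearMap.range d₁ ⊔ J • ⊤

theorem range_sup_le_of_congr {J : Ideal S} {d₁ d₁' : F₁ →ₗ[S] F₀}
    (h₁ : ∀ w, d₁' w - d₁ w ∈ (J • ⊤ : Submodule S F₀)) :
    LinearMap.range d₁ ⊔ J • ⊤ = LinearMap.range d₁' ⊔ J • ⊤ := by
  apply le_antisymm <;> refine sup_le ?_ le_sup_right
  · rintro _ ⟨w, rfl⟩
    rw [← sub_sub_cancel (d₁' w) (d₁ w)]
    exact sub_mem (Submodule.mem_sup_left ⟨w, rfl⟩) (Submodule.mem_sup_right (h₁ w))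
  · rintro _ ⟨w, rfl⟩
    rw [← add_sub_cancel (d₁ w) (d₁' w)]
    exact add_mem (Submodule.mem_sup_left ⟨w, rfl⟩) (Submodule.mem_sup_right (h₁ w))

theorem IsExactMod.congr {J : Ideal S} {d₁ d₁' : F₁ →ₗ[S] F₀} {d₂ d₂' : F₂ →ₗ[S] F₁}
    (h : IsExactMod J d₁ d₂) (h₁ : ∀ w, d₁' w - d₁ w ∈ (J • ⊤ : Submodule S F₀))
    (h₂ : ∀ u, d₂' u - d₂ u ∈ (J • ⊤ : Submodule S F₁)) : IsExactMod J d₁' d₂' := by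
  have hr := range_sup_le_of_congr h₁
  refine ⟨fun u => ?_, fun w hw => ?_, fun f hf => ?_⟩
  · have := add_mem (add_mem (h.comp_mem u) (d₁.map_mem_smul_top (h₂ u))) (h₁ (d₂' u))
    rwa [map_sub, add_sub_cancel, add_sub_cancel] at this
  · obtain ⟨u, hu⟩ := h.exact_mem w (by simpa using sub_mem hw (h₁ w))
    exact ⟨u, by simpa using sub_mem hu (h₂ u)⟩
  · obtain ⟨g, hg⟩ := h.lift_mem f (fun u hu => hr ▸ hf u (by simpa using add_mem hu (h₂ u)))
    refine ⟨g, fun u => hr ▸ ?_⟩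
    have := sub_mem (hg u) (Submodule.mem_sup_right (g.map_mem_smul_top (h₂ u)))
    simpa using this

variable {J : Ideal S} {x : S} {d₁ : F₁ →ₗ[S] F₀} {d₂ : F₂ →ₗ[S] F₁}

/-- One step of the construction of a lift. -/
theorem IsExactMod.exists_step [Module.Projective S F₁] [Module.Projective S F₂]
    (hreg : ∀ v : F₀, x • v ∈ (J • ⊤ : Submodule S F₀) → v ∈ (J • ⊤ : Submodule S F₀))
    (h : IsExactMod (J ⊔ Ideal.span {x}) d₁ d₂) (n : ℕ)
    (hn : ∀ u, ∃ v, d₁ (d₂ u) - x ^ (n + 1) • v ∈ (J • ⊤ : Submodule S F₀)) :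
    ∃ (g : F₁ →ₗ[S] F₀) (k : F₂ →ₗ[S] F₁), ∀ u, ∃ v,
      (d₁ + x ^ (n + 1) • g) ((d₂ + x ^ (n + 1) • k) u) - x ^ (n + 2) • v ∈
        (J • ⊤ : Submodule S F₀) := by
  have hregn : ∀ (m : ℕ) (v : F₀), x ^ m • v ∈ (J • ⊤ : Submodule S F₀) →
      v ∈ (J • ⊤ : Submodule S F₀) := by
    intro m
    induction m with
    | zero => simp
    | succ m ih =>
      intro v hv
      rw [pow_succ, mul_smul] at hv
      exact hreg v (ih _ hv)
  -- the obstruction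
  obtain ⟨σρ, hσρ⟩ := Module.exists_comp_eq_of_forall_mem_range
    ((x ^ (n + 1) • (LinearMap.id : F₀ →ₗ[S] F₀)).coprod (J • ⊤ : Submodule S F₀).subtype)
    (d₁ ∘ₗ d₂) (fun u => by
      obtain ⟨v, hv⟩ := hn u
      exact ⟨(v, ⟨_, hv⟩), by simp⟩)
  let σ : F₂ →ₗ[S] F₀ := LinearMap.fst _ _ _ ∘ₗ σρ
  have hσ : ∀ u, d₁ (d₂ u) - x ^ (n + 1) • σ u ∈ (J • ⊤ : Submodule S F₀) := by
    intro u
    have := hσρ u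
    simp only [LinearMap.coprod_apply, LinearMap.comp_apply] at this
    rw [← this]
    simp [σ]
  have hdesc : ∀ j k : ℕ, k + j = n → ∀ u w, d₂ u - x ^ (k + 1) • w ∈ (J • ⊤ : Submodule S F₁) →
      σ u ∈ LinearMap.range d₁ ⊔ (J ⊔ Ideal.span {x}) • ⊤ := by
    intro j
    induction j with
    | zero =>
      rintro k rfl u w hw
      have h1 := hregn (k + 0 + 1) (σ u - d₁ w) (by
        have := sub_mem (d₁.map_mem_smul_top hw) (hσ u)
        rw [map_sub, map_smul] at this
        convert this using 1
        rw [add_zero]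
        module)
      rw [← add_sub_cancel (d₁ w) (σ u)]
      exact add_mem (Submodule.mem_sup_left ⟨w, rfl⟩)
        (Submodule.mem_sup_right (Submodule.smul_mono_left le_sup_left h1))
    | succ j ih =>
      rintro k rfl u w hw
      have h1 := hregn (k + 1) (d₁ w - x ^ (j + 1) • σ u) (by
        have := sub_mem (hσ u) (d₁.map_mem_smul_top hw)
        rw [map_sub, map_smul] at this
        convert this using 1
        module)
      obtain ⟨u', hu'⟩ := h.exact_mem w (Submodule.mem_sup_span_singleton_smul_top.2
        ⟨x ^ j • σ u, by rwa [smul_smul, ← pow_succ']⟩)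
      obtain ⟨w', hw'⟩ := Submodule.mem_sup_span_singleton_smul_top.1 hu'
      have h2 := ih (k + 1) (by ring) (u - x ^ (k + 1) • u') w' (by
        have := add_mem hw (Submodule.smul_mem _ (x ^ (k + 1)) hw')
        rw [map_sub, map_smul]
        convert this using 1
        module)
      rw [map_sub, map_smul] at h2
      rw [← sub_add_cancel (σ u) (x ^ (k + 1) • σ u')]
      refine add_mem h2 (Submodule.mem_sup_right
        (Submodule.mem_sup_span_singleton_smul_top.2 ⟨x ^ k • σ u', ?_⟩))
      rw [smul_smul, ← pow_succ', sub_self]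
      exact zero_mem _
  obtain ⟨g, hg⟩ := h.lift_mem σ (fun u hu => by
    obtain ⟨w, hw⟩ := Submodule.mem_sup_span_singleton_smul_top.1 hu
    exact hdesc n 0 (zero_add n) u w (by simpa using hw))
  obtain ⟨k, hk⟩ := Module.exists_comp_eq_of_forall_mem_range
    (d₁.coprod ((J ⊔ Ideal.span {x}) • ⊤ : Submodule S F₀).subtype) (σ - g ∘ₗ d₂) (fun u => by
      obtain ⟨_, ⟨w, rfl⟩, b, hb, hwb⟩ := Submodule.mem_sup.1 (hg u)
      exact ⟨(w, ⟨b, hb⟩), hwb⟩)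
  refine ⟨-g, -(LinearMap.fst _ _ _ ∘ₗ k), fun u => ?_⟩
  obtain ⟨v, hv⟩ := Submodule.mem_sup_span_singleton_smul_top.1 (k u).2.2
  have hku : d₁ (k u).1 + (k u).2 = σ u - g (d₂ u) := hk u
  refine ⟨v + x ^ n • g (k u).1, ?_⟩
  have := add_mem (hσ u) (Submodule.smul_mem _ (x ^ (n + 1)) hv)
  convert this using 1
  rw [eq_sub_of_add_eq' hku]
  simp only [LinearMap.add_apply, LinearMap.smul_apply, LinearMap.neg_apply, LinearMap.comp_apply,
    LinearMap.fst_apply, map_add, map_smul, map_neg]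
  module

variable [IsLocalRing S] [IsNoetherianRing S] [Module.Finite S F₀] [Module.Finite S F₁]
  [Module.Finite S F₂]

theorem IsExactMod.exists_lift_comp_mem [IsPrecomplete (maximalIdeal S) S]
    [Module.Projective S F₁] [Module.Projective S F₂] (hx : x ∈ maximalIdeal S)
    (hreg : ∀ v : F₀, x • v ∈ (J • ⊤ : Submodule S F₀) → v ∈ (J • ⊤ : Submodule S F₀))
    (h : IsExactMod (J ⊔ Ideal.span {x}) d₁ d₂) :
    ∃ (e₁ : F₁ →ₗ[S] F₀) (e₂ : F₂ →ₗ[S] F₁), ∀ u,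
      (d₁ + x • e₁) ((d₂ + x • e₂) u) ∈ (J • ⊤ : Submodule S F₀) := by
  let H := (F₁ →ₗ[S] F₀) × (F₂ →ₗ[S] F₁)
  have : IsPrecomplete (maximalIdeal S) H := isPrecomplete_of_finite _ H
  have hcongr : ∀ p : H, (∃ e : H, p = (d₁, d₂) + x • e) →
      IsExactMod (J ⊔ Ideal.span {x}) p.1 p.2 := by
    rintro _ ⟨e, rfl⟩
    refine h.congr (fun w => Submodule.mem_sup_span_singleton_smul_top.2 ⟨e.1 w, ?_⟩)
      (fun u => Submodule.mem_sup_span_singleton_smul_top.2 ⟨e.2 u, ?_⟩)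
    · change d₁ w + x • e.1 w - d₁ w - x • e.1 w ∈ _
      simp
    · change d₂ u + x • e.2 u - d₂ u - x • e.2 u ∈ _
      simp
  obtain ⟨e, he⟩ := exists_limit_of_step hx (fun n (p : H) => (∃ e : H, p = (d₁, d₂) + x • e) ∧
    ∀ u, ∃ v, p.1 (p.2 u) - x ^ (n + 1) • v ∈ (J • ⊤ : Submodule S F₀)) (d₁, d₂)
    ⟨⟨0, by simp⟩, fun u => by
      simpa using Submodule.mem_sup_span_singleton_smul_top.1 (h.comp_mem u)⟩
    (fun n p ⟨⟨e, he⟩, hp⟩ => by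
      obtain ⟨g, k, hgk⟩ := (hcongr p ⟨e, he⟩).exists_step hreg n hp
      exact ⟨(g, k), ⟨e + x ^ n • (g, k), by rw [he]; module⟩, hgk⟩)
  refine ⟨e.1, e.2, fun u => ?_⟩
  set d : H := (d₁, d₂) + x • e with hd
  change d.1 (d.2 u) ∈ _
  rw [← Submodule.Quotient.mk_eq_zero]
  refine IsHausdorff.haus (I := maximalIdeal S) inferInstance _ fun n => SModEq.zero.2 ?_
  obtain ⟨p, ⟨-, hp⟩, hdp⟩ := he n
  obtain ⟨v, hv⟩ := hp u
  have h1 := ((LinearMap.applyₗ (d.2 u)).comp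
    (LinearMap.fst S (F₁ →ₗ[S] F₀) (F₂ →ₗ[S] F₁))).map_mem_smul_top hdp
  have h2 := ((p.1.comp (LinearMap.applyₗ u)).comp
    (LinearMap.snd S (F₁ →ₗ[S] F₀) (F₂ →ₗ[S] F₁))).map_mem_smul_top hdp
  have h3 : x ^ (n + 1) • v ∈ (maximalIdeal S ^ n • ⊤ : Submodule S F₀) :=
    Submodule.smul_mem_smul (Ideal.pow_le_pow_right n.le_succ (Ideal.pow_mem_pow hx _)) trivial
  have h4 : d.1 (d.2 u) = (d.1 - p.1) (d.2 u) + p.1 ((d.2 - p.2) u) + x ^ (n + 1) • v +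
      (p.1 (p.2 u) - x ^ (n + 1) • v) := by
    simp only [LinearMap.sub_apply, map_sub]
    abel
  have h5 := ((J • ⊤ : Submodule S F₀).mkQ).map_mem_smul_top (add_mem (add_mem h1 h2) h3)
  rw [h4, Submodule.Quotient.mk_add, (Submodule.Quotient.mk_eq_zero _).2 hv, add_zero]
  exact h5

/-- A sequence exact modulo `J` and `x`, which is a complex modulo `J`, is exact modulo `J`, and
`x` is regular on the cokernel modulo `J`. -/
theorem IsExactMod.of_comp_mem [Module.Projective S F₂] (hx : x ∈ maximalIdeal S)
    (hreg₀ : ∀ v : F₀, x • v ∈ (J • ⊤ : Submodule S F₀) → v ∈ (J • ⊤ : Submodule S F₀))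
    (h : IsExactMod (J ⊔ Ideal.span {x}) d₁ d₂)
    (hc : ∀ u, d₁ (d₂ u) ∈ (J • ⊤ : Submodule S F₀)) :
    IsExactMod J d₁ d₂ ∧
      ∀ v, x • v ∈ LinearMap.range d₁ ⊔ J • ⊤ → v ∈ LinearMap.range d₁ ⊔ J • ⊤ := by
  have hexact : ∀ w, d₁ w ∈ (J ⊔ Ideal.span {x}) • (⊤ : Submodule S F₀) →
      ∃ u w', w - d₂ u - x • w' ∈ (J • ⊤ : Submodule S F₁) ∧
        d₁ w - x • d₁ w' ∈ (J • ⊤ : Submodule S F₀) := by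
    intro w hw
    obtain ⟨u, hu⟩ := h.exact_mem w hw
    obtain ⟨w', hw'⟩ := Submodule.mem_sup_span_singleton_smul_top.1 hu
    refine ⟨u, w', hw', ?_⟩
    have := add_mem (d₁.map_mem_smul_top hw') (hc u)
    rwa [map_sub, map_sub, map_smul, sub_right_comm, sub_add_cancel] at this
  have hJ : ∀ v, v ∈ (J • ⊤ : Submodule S F₀) → v ∈ (J ⊔ Ideal.span {x}) • (⊤ : Submodule S F₀) :=
    fun v hv => Submodule.smul_mono_left le_sup_left hv
  have hE1 : ∀ w, d₁ w ∈ (J • ⊤ : Submodule S F₀) →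
      ∃ u, w - d₂ u ∈ (J • ⊤ : Submodule S F₁) := by
    have key : (J • ⊤ : Submodule S F₀).comap d₁ ≤ LinearMap.range d₂ ⊔ J • ⊤ := by
      refine Submodule.le_of_le_smul_of_le_jacobson_bot (I := maximalIdeal S)
        (IsNoetherian.noetherian _) (maximalIdeal_le_jacobson _) fun w hw => ?_
      obtain ⟨u, w', hw', hdw⟩ := hexact w (hJ _ hw)
      have h1 : d₁ w' ∈ (J • ⊤ : Submodule S F₀) :=
        hreg₀ _ (by simpa using sub_mem (Submodule.mem_comap.1 hw) hdw)
      rw [← sub_add_cancel w (x • w'), ← sub_add_cancel (w - x • w') (d₂ u), sub_right_comm]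
      refine add_mem (Submodule.mem_sup_left (add_mem (Submodule.mem_sup_right hw')
        (Submodule.mem_sup_left ⟨u, rfl⟩))) (Submodule.mem_sup_right
          (Submodule.smul_mem_smul hx h1))
    intro w hw
    obtain ⟨_, ⟨u, rfl⟩, b, hb, rfl⟩ := Submodule.mem_sup.1 (key (Submodule.mem_comap.2 hw))
    exact ⟨u, by rwa [add_sub_cancel_left]⟩
  have hE3 : ∀ v, x • v ∈ LinearMap.range d₁ ⊔ J • ⊤ → v ∈ LinearMap.range d₁ ⊔ J • ⊤ := by
    intro v hv
    obtain ⟨_, ⟨w, rfl⟩, b, hb, hwb⟩ := Submodule.mem_sup.1 hv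
    obtain ⟨u, w', hw', hdw⟩ := hexact w (Submodule.mem_sup_span_singleton_smul_top.2
      ⟨v, by rw [← hwb, sub_add_cancel_left]; exact neg_mem hb⟩)
    have h1 := hreg₀ (v - d₁ w') (by
      have := add_mem hdw hb
      rwa [sub_add_eq_add_sub, hwb, ← smul_sub] at this)
    rw [← sub_add_cancel v (d₁ w')]
    exact add_mem (Submodule.mem_sup_right h1) (Submodule.mem_sup_left ⟨w', rfl⟩)
  refine ⟨⟨hc, hE1, ?_⟩, hE3⟩
  let B := LinearMap.range d₁ ⊔ (J • ⊤ : Submodule S F₀)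
  let Z : Submodule S (F₂ →ₗ[S] F₀) :=
    { carrier := {f | ∀ u, d₂ u ∈ (J • ⊤ : Submodule S F₁) → f u ∈ B}
      add_mem' := fun ha hb u hu => add_mem (ha u hu) (hb u hu)
      zero_mem' := fun u _ => zero_mem _
      smul_mem' := fun c f hf u hu => B.smul_mem c (hf u hu) }
  let N : Submodule S (F₂ →ₗ[S] F₀) :=
    { carrier := {f | ∃ g : F₁ →ₗ[S] F₀, ∀ u, f u - g (d₂ u) ∈ B}
      add_mem' := by
        rintro f f' ⟨g, hg⟩ ⟨g', hg'⟩
        refine ⟨g + g', fun u => ?_⟩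
        have := add_mem (hg u) (hg' u)
        rwa [sub_add_sub_comm] at this
      zero_mem' := ⟨0, fun u => by simp⟩
      smul_mem' := by
        rintro c f ⟨g, hg⟩
        refine ⟨c • g, fun u => ?_⟩
        have := B.smul_mem c (hg u)
        rwa [smul_sub] at this }
  have key : Z ≤ N := by
    refine Submodule.le_of_le_smul_of_le_jacobson_bot (I := maximalIdeal S)
      (IsNoetherian.noetherian _) (maximalIdeal_le_jacobson _) fun f hf => ?_
    have hf : ∀ u, d₂ u ∈ (J • ⊤ : Submodule S F₁) → f u ∈ B := hf
    obtain ⟨g, hg⟩ := h.lift_mem f (fun u hu => by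
      obtain ⟨w, hw⟩ := Submodule.mem_sup_span_singleton_smul_top.1 hu
      have h1 : d₁ w ∈ (J • ⊤ : Submodule S F₀) := hreg₀ _ (by
        have := sub_mem (hc u) (d₁.map_mem_smul_top hw)
        rwa [map_sub, sub_sub_cancel, map_smul] at this)
      obtain ⟨u', hu'⟩ := hE1 w h1
      have h2 := hf (u - x • u') (by
        have := add_mem hw (Submodule.smul_mem _ x hu')
        rwa [smul_sub, sub_add_sub_cancel, ← map_smul, ← map_sub] at this)
      rw [← sub_add_cancel (f u) (x • f u'), ← map_smul, ← map_sub]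
      refine add_mem ((sup_le_sup le_rfl (fun v hv => hJ v hv) : B ≤ _) h2) (Submodule.mem_sup_right
        (Submodule.mem_sup_span_singleton_smul_top.2 ⟨f u', ?_⟩))
      rw [map_smul, sub_self]
      exact zero_mem _)
    obtain ⟨k, hk⟩ := Module.exists_comp_eq_of_forall_mem_range
      (B.subtype.coprod (x • (LinearMap.id : F₀ →ₗ[S] F₀))) (f - g ∘ₗ d₂) (fun u => by
        obtain ⟨a, ha, b, hb, hab⟩ := Submodule.mem_sup.1 (hg u)
        obtain ⟨v, hv⟩ := Submodule.mem_sup_span_singleton_smul_top.1 hb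
        refine ⟨(⟨a + (b - x • v), add_mem (Submodule.mem_sup_left ha)
          (Submodule.mem_sup_right hv)⟩, v), ?_⟩
        change a + (b - x • v) + x • v = f u - g (d₂ u)
        rw [add_assoc, sub_add_cancel, hab])
    have hk : ∀ u, ((k u).1 : F₀) + x • (k u).2 = f u - g (d₂ u) := hk
    let f' : F₂ →ₗ[S] F₀ := LinearMap.snd _ _ _ ∘ₗ k
    have hf' : f' ∈ Z := fun u hu => hE3 _ (by
      change x • (k u).2 ∈ B
      rw [eq_sub_of_add_eq' (hk u)]
      exact sub_mem (sub_mem (hf u hu) (Submodule.mem_sup_right (g.map_mem_smul_top hu)))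
        (k u).1.2)
    rw [← sub_add_cancel f (x • f')]
    refine Submodule.add_mem_sup ⟨g, fun u => ?_⟩ (Submodule.smul_mem_smul hx hf')
    change f u - x • (k u).2 - g (d₂ u) ∈ B
    rw [sub_right_comm, ← hk u, add_sub_cancel_right]
    exact (k u).1.2
  exact fun f hf => key hf

end Lifting

end

section

open IsLocalRing RingTheory.Sequence

/-- A sequence exact modulo a regular sequence deforms to one whose cokernel is a deformation. -/
theorem IsExactMod.exists_isWeaklyRegular {S : Type} [CommRing S] [IsLocalRing S]
    [IsNoetherianRing S] [IsPrecomplete (maximalIdeal S) S] {F₁ F₂ : Type} [AddCommGroup F₁]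
    [Module S F₁] [AddCommGroup F₂] [Module S F₂] [Module.Finite S F₁] [Module.Finite S F₂]
    [Module.Projective S F₁] [Module.Projective S F₂] {b : ℕ} (xs : List S)
    (hxs : IsWeaklyRegular S xs) (hm : ∀ x ∈ xs, x ∈ maximalIdeal S)
    {d₁ : F₁ →ₗ[S] (Fin b → S)} {d₂ : F₂ →ₗ[S] F₁} (h : IsExactMod (Ideal.ofList xs) d₁ d₂) :
    ∃ d₁' : F₁ →ₗ[S] (Fin b → S),
      (∀ w, d₁' w - d₁ w ∈ (Ideal.ofList xs • ⊤ : Submodule S (Fin b → S))) ∧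
      IsWeaklyRegular ((Fin b → S) ⧸ LinearMap.range d₁') xs := by
  induction xs using List.reverseRecOn generalizing d₁ d₂ with
  | nil => exact ⟨d₁, fun w => by simp, IsWeaklyRegular.nil _ _⟩
  | append_singleton ys x ih =>
    rw [isWeaklyRegular_append_iff, isWeaklyRegular_singleton_iff,
      isSMulRegular_quotient_iff_mem_of_smul_mem] at hxs
    rw [Ideal.ofList_append, Ideal.ofList_singleton] at h ⊢
    have hx : x ∈ maximalIdeal S := hm x (by simp)
    have hreg : ∀ v : Fin b → S, x • v ∈ (Ideal.ofList ys • ⊤ : Submodule S (Fin b → S)) →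
        v ∈ (Ideal.ofList ys • ⊤ : Submodule S (Fin b → S)) := by
      intro v hv
      rw [mem_smul_top_pi_iff] at hv ⊢
      intro i
      simpa using hxs.2 (v i) (by simpa using hv i)
    obtain ⟨e₁, e₂, hc⟩ := h.exists_lift_comp_mem hx hreg
    have h' := (h.congr (d₁' := d₁ + x • e₁) (d₂' := d₂ + x • e₂)
      (fun w => Submodule.mem_sup_span_singleton_smul_top.2 ⟨e₁ w, by simp⟩)
      (fun u => Submodule.mem_sup_span_singleton_smul_top.2 ⟨e₂ u, by simp⟩)).of_comp_mem hx hreg hc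
    obtain ⟨d, hd, hreg'⟩ := ih hxs.1 (fun y hy => hm y (by simp [hy])) h'.1
    refine ⟨d, fun w => Submodule.mem_sup_span_singleton_smul_top.2 ⟨e₁ w, ?_⟩, ?_⟩
    · simpa [sub_sub] using hd w
    · rw [isWeaklyRegular_append_iff, isWeaklyRegular_singleton_iff,
        isSMulRegular_quotient_iff_mem_of_smul_mem]
      refine ⟨hreg', fun y hy => ?_⟩
      obtain ⟨v, rfl⟩ := (LinearMap.range d).mkQ_surjective y
      have hmem : ∀ v, (LinearMap.range d).mkQ v ∈ (Ideal.ofList ys • ⊤ :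
          Submodule S ((Fin b → S) ⧸ LinearMap.range d)) ↔
          v ∈ LinearMap.range (d₁ + x • e₁) ⊔ Ideal.ofList ys • ⊤ := by
        intro v
        have htop : (Ideal.ofList ys • ⊤ : Submodule S ((Fin b → S) ⧸ LinearMap.range d)) =
            (Ideal.ofList ys • ⊤ : Submodule S (Fin b → S)).map (LinearMap.range d).mkQ := by
          rw [Submodule.map_smul'', Submodule.map_top, Submodule.range_mkQ]
        rw [range_sup_le_of_congr hd, htop, ← Submodule.mem_comap, Submodule.comap_map_mkQ]
      rw [← map_smul, hmem] at hy
      exact (hmem v).2 (h'.2 v hy)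

/-- Modules over a quotient by a regular sequence satisfying the extension property on second
syzygies deform along the regular sequence. -/
theorem exists_deformation {S A D : Type} [CommRing S] [IsLocalRing S] [IsNoetherianRing S]
    [IsPrecomplete (maximalIdeal S) S] [CommRing A] [Algebra S A] [AddCommGroup D] [Module A D]
    [Module S D] [IsScalarTower S A D] [Module.Finite A D] [IsNoetherianRing A]
    (hS : Function.Surjective (algebraMap S A)) {xs : List S}
    (hker : RingHom.ker (algebraMap S A) = Ideal.ofList xs)
    (hxs : IsWeaklyRegular S xs) (hm : ∀ x ∈ xs, x ∈ maximalIdeal S)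
    (hext : ∀ (b c : ℕ) (d : (Fin c → A) →ₗ[A] (Fin b → A)) (p : (Fin b → A) →ₗ[A] D),
      Function.Surjective p → LinearMap.ker p = LinearMap.range d →
      ∀ f : LinearMap.ker d →ₗ[A] D, ∃ g : (Fin c → A) →ₗ[A] D, ∀ z : LinearMap.ker d, g z = f z) :
    ∃ (D' : Type) (_ : AddCommGroup D') (_ : Module S D') (π : D' →ₗ[S] D),
      Module.Finite S D' ∧ Function.Surjective π ∧
      LinearMap.ker π = Ideal.ofList xs • ⊤ ∧ IsWeaklyRegular D' xs := by
  obtain ⟨b₀, p, hp⟩ := Module.Finite.exists_fin' A D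
  obtain ⟨b₁, p₁, hp₁⟩ := Module.Finite.exists_fin' A (LinearMap.ker p)
  let δ₁ := (LinearMap.ker p).subtype ∘ₗ p₁
  have hδ₁ : LinearMap.ker p = LinearMap.range δ₁ := by
    rw [LinearMap.range_comp, LinearMap.range_eq_top.2 hp₁, Submodule.map_top, Submodule.range_subtype]
  obtain ⟨b₂, p₂, hp₂⟩ := Module.Finite.exists_fin' A (LinearMap.ker δ₁)
  let red : ∀ b : ℕ, (Fin b → S) →ₗ[S] (Fin b → A) := fun b => (Algebra.linearMap S A).compLeft (Fin b)
  have hred : ∀ b, Function.Surjective (red b) := fun b => hS.comp_left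
  have hredker : ∀ b v, red b v = 0 ↔ v ∈ (Ideal.ofList xs • ⊤ : Submodule S (Fin b → S)) := by
    intro b v
    rw [mem_smul_top_pi_iff, ← hker]
    exact funext_iff
  obtain ⟨d₁, hd₁⟩ := Module.projective_lifting_property (red b₀)
    (δ₁.restrictScalars S ∘ₗ red b₁) (hred b₀)
  obtain ⟨d₂, hd₂⟩ := Module.projective_lifting_property (red b₁)
    ((LinearMap.ker δ₁).subtype.restrictScalars S ∘ₗ p₂.restrictScalars S ∘ₗ red b₂) (hred b₁)
  have hd₁ : ∀ w, red b₀ (d₁ w) = δ₁ (red b₁ w) := fun w => LinearMap.congr_fun hd₁ w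
  have hd₂ : ∀ w, red b₁ (d₂ w) = p₂ (red b₂ w) := fun w => LinearMap.congr_fun hd₂ w
  let q : (Fin b₀ → S) →ₗ[S] D := p.restrictScalars S ∘ₗ red b₀
  have hq : Function.Surjective q := hp.comp (hred b₀)
  have hqker : LinearMap.ker q = LinearMap.range d₁ ⊔ Ideal.ofList xs • ⊤ := by
    apply le_antisymm
    · intro v hv
      have hv : red b₀ v ∈ LinearMap.range δ₁ := hδ₁ ▸ hv
      obtain ⟨w, hw⟩ := hv
      obtain ⟨w, rfl⟩ := hred b₁ w
      rw [← hd₁] at hw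
      rw [← add_sub_cancel (d₁ w) v]
      exact Submodule.add_mem_sup ⟨w, rfl⟩ ((hredker _ _).1 (by rw [map_sub, hw, sub_self]))
    · refine sup_le ?_ fun v hv => ?_
      · rintro _ ⟨w, rfl⟩
        have : red b₀ (d₁ w) ∈ LinearMap.ker p := by
          rw [hd₁, hδ₁]
          exact ⟨_, rfl⟩
        exact this
      · change p (red b₀ v) = 0
        rw [(hredker _ _).2 hv, map_zero]
  have hE : IsExactMod (Ideal.ofList xs) d₁ d₂ := by
    refine ⟨fun u => ?_, fun w hw => ?_, fun f hf => ?_⟩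
    · rw [← hredker, hd₁, hd₂]
      exact (p₂ (red b₂ u)).2
    · rw [← hredker, hd₁] at hw
      obtain ⟨u, hu⟩ := hp₂ ⟨red b₁ w, hw⟩
      obtain ⟨u, rfl⟩ := hred b₂ u
      exact ⟨u, by rw [← hredker, map_sub, hd₂, hu, sub_self]⟩
    · let r : (Fin b₂ → S) →ₗ[S] LinearMap.ker δ₁ := p₂.restrictScalars S ∘ₗ red b₂
      have hr : Function.Surjective r := hp₂.comp (hred b₂)
      have hrk : LinearMap.ker r ≤ LinearMap.ker (q ∘ₗ f) := by
        intro u hu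
        have hu : p₂ (red b₂ u) = 0 := hu
        have := hf u (by rw [← hredker, hd₂, hu]; rfl)
        rwa [← hqker] at this
      let φ : LinearMap.ker δ₁ →ₗ[S] D :=
        (LinearMap.ker r).liftQ (q ∘ₗ f) hrk ∘ₗ (r.quotKerEquivOfSurjective hr).symm.toLinearMap
      have hφ : ∀ u, φ (r u) = q (f u) := by
        intro u
        change (LinearMap.ker r).liftQ (q ∘ₗ f) hrk ((r.quotKerEquivOfSurjective hr).symm (r u)) = _
        rw [LinearMap.quotKerEquivOfSurjective_symm_apply]
        rfl
      obtain ⟨g, hg⟩ := hext _ _ δ₁ p hp hδ₁ (φ.extendScalarsOfSurjective hS)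
      obtain ⟨g', hg'⟩ := Module.projective_lifting_property q (g.restrictScalars S ∘ₗ red b₁) hq
      refine ⟨g', fun u => ?_⟩
      rw [← hqker, LinearMap.mem_ker, map_sub, ← hφ, sub_eq_zero]
      have := LinearMap.congr_fun hg' (d₂ u)
      refine Eq.trans ?_ this.symm
      change _ = g (red b₁ (d₂ u))
      rw [hd₂, hg]
      rfl
  obtain ⟨d, hd, hreg⟩ := hE.exists_isWeaklyRegular xs hxs hm
  rw [range_sup_le_of_congr hd] at hqker
  refine ⟨_, inferInstance, inferInstance,
    (LinearMap.range d).liftQ q (hqker ▸ le_sup_left), inferInstance, ?_, ?_, hreg⟩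
  · intro y
    obtain ⟨v, rfl⟩ := hq y
    exact ⟨Submodule.Quotient.mk v, rfl⟩
  · rw [Submodule.ker_liftQ, hqker, Submodule.map_sup, Submodule.map_smul'', Submodule.map_top,
      Submodule.range_mkQ, Submodule.mkQ_map_self, bot_sup_eq]

end

section

open IsLocalRing

/-- A finite algebra carrying a nondegenerate form with values in the injective hull of the
residue field is self-injective. -/
theorem baer_of_nondegenerate {A S I : Type} [CommRing A] [IsLocalRing A] [CommRing S]
    [Algebra A S] [AddCommGroup I] [Module A I] [Module.Injective A I] {i₀ : I} (h0 : i₀ ≠ 0)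
    (hi₀ : ∀ r ∈ maximalIdeal A, r • i₀ = 0) (h : ∀ y : I, y ≠ 0 → ∃ r : A, r • y = i₀)
    (hS : IsFiniteLength A S) (l : S →ₗ[A] I) (hl : ∀ s, (∀ t, l (s * t) = 0) → s = 0) :
    Module.Baer S S := by
  let P : S →ₗ[A] S →ₗ[A] I := (LinearMap.mul A S).compr₂ l
  have hP : Function.Injective P := by
    rw [injective_iff_map_eq_zero]
    exact fun s hs => hl s fun t => LinearMap.congr_fun hs t
  have hP' := P.surjective_of_injective_of_length_le hP hS (length_linearMap_le h0 hi₀ h S hS)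
  intro J g
  obtain ⟨f, hf⟩ := Module.Injective.exists_comp_eq (J.subtype.restrictScalars A)
    (l ∘ₗ g.restrictScalars A) (fun x hx => by
      rw [show x = 0 from Subtype.ext hx]
      exact zero_mem _)
  obtain ⟨s, rfl⟩ := hP' f
  refine ⟨LinearMap.mulLeft S s, fun x hx => ?_⟩
  rw [← sub_eq_zero]
  refine hl _ fun t => ?_
  have h1 : l (s * (t * x)) = l (g ⟨t * x, J.mul_mem_left t hx⟩) :=
    LinearMap.congr_fun hf ⟨t * x, J.mul_mem_left t hx⟩
  have h2 : g ⟨t * x, J.mul_mem_left t hx⟩ = t * g ⟨x, hx⟩ := g.map_smul t ⟨x, hx⟩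
  rw [h2] at h1
  rw [sub_mul, map_sub, sub_eq_zero]
  convert h1 using 2
  · simp only [LinearMap.mulLeft_apply]; ring
  · ring

theorem isArtinian_of_smul_eq_zero {A N : Type} [CommRing A] [AddCommGroup N] [Module A N]
    [Module.Finite A N] (J : Ideal A) [IsArtinian A (A ⧸ J)] (h : ∀ a ∈ J, ∀ x : N, a • x = 0) :
    IsArtinian A N := by
  obtain ⟨n, p, hp⟩ := Module.Finite.exists_fin' A N
  refine isArtinian_of_surjective (Fin n → A ⧸ J) (LinearMap.lsum A (fun _ => A ⧸ J) A fun i =>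
    Submodule.liftQ J (LinearMap.toSpanSingleton A N (p (Pi.single i 1))) fun a ha => h a ha _) ?_
  intro y
  obtain ⟨v, rfl⟩ := hp y
  refine ⟨fun i => Submodule.Quotient.mk (v i), ?_⟩
  rw [LinearMap.lsum_apply, ← Finset.univ_sum_single v, map_sum, LinearMap.sum_apply]
  refine Finset.sum_congr rfl fun i _ => ?_
  rw [Finset.univ_sum_single]
  change v i • p (Pi.single i 1) = _
  rw [← map_smul, ← Pi.single_smul, smul_eq_mul, mul_one]

end

section

open IsLocalRing

/-- The trivial extension of a ring by a module, described through its underlying module. -/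
theorem exists_trivialExtension (A D : Type) [CommRing A] [AddCommGroup D] [Module A D] :
    ∃ (T : Type) (_ : CommRing T) (_ : Algebra A T) (e : T ≃ₗ[A] A × D),
      ∀ s t, e (s * t) = ((e s).1 * (e t).1, (e s).1 • (e t).2 + (e t).1 • (e s).2) := by
  let _ : Module Aᵐᵒᵖ D := Module.compHom D ((RingHom.id A).fromOpposite mul_comm)
  have : IsCentralScalar A D := ⟨fun _ _ => rfl⟩
  exact ⟨TrivSqZeroExt A D, inferInstance, inferInstance, LinearEquiv.refl A (A × D),
    fun s t => rfl⟩

theorem mem_smul_top_prod_iff {A M N : Type} [CommRing A] [AddCommGroup M] [Module A M]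
    [AddCommGroup N] [Module A N] {J : Ideal A} {v : M × N} :
    v ∈ (J • ⊤ : Submodule A (M × N)) ↔
      v.1 ∈ (J • ⊤ : Submodule A M) ∧ v.2 ∈ (J • ⊤ : Submodule A N) := by
  refine ⟨fun h => ⟨(LinearMap.fst A M N).map_mem_smul_top h,
    (LinearMap.snd A M N).map_mem_smul_top h⟩, fun h => ?_⟩
  have := add_mem ((LinearMap.inl A M N).map_mem_smul_top h.1)
    ((LinearMap.inr A M N).map_mem_smul_top h.2)
  simpa using this

open RingTheory.Sequence in
theorem RingTheory.Sequence.IsWeaklyRegular.prod {A M N : Type} [CommRing A]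
    [AddCommGroup M] [Module A M] [AddCommGroup N] [Module A N] {xs : List A} (hM : IsWeaklyRegular M xs)
    (hN : IsWeaklyRegular N xs) : IsWeaklyRegular (M × N) xs := by
  refine ⟨fun i hi => isSMulRegular_quotient_iff_mem_of_smul_mem _ _ |>.2 fun v hv => ?_⟩
  rw [mem_smul_top_prod_iff] at hv ⊢
  exact ⟨(isSMulRegular_quotient_iff_mem_of_smul_mem _ _).1 (hM.1 i hi) _ hv.1,
    (isSMulRegular_quotient_iff_mem_of_smul_mem _ _).1 (hN.1 i hi) _ hv.2⟩

section TrivialExtension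

variable {A T D : Type} [CommRing A] [CommRing T] [Algebra A T] [AddCommGroup D] [Module A D]
  (e : T ≃ₗ[A] A × D)

theorem trivialExtension_mem_map_iff (J : Ideal A) {t : T} :
    t ∈ J.map (algebraMap A T) ↔ (e t).1 ∈ J ∧ (e t).2 ∈ J • (⊤ : Submodule A D) := by
  have h : t ∈ J.map (algebraMap A T) ↔ t ∈ (J • ⊤ : Submodule A T) := by
    rw [Ideal.smul_top_eq_map]
    rfl
  rw [h]
  refine Iff.trans ⟨fun ht => e.toLinearMap.map_mem_smul_top ht, fun ht => ?_⟩
    (mem_smul_top_prod_iff.trans (by simp))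
  simpa using e.symm.toLinearMap.map_mem_smul_top ht

variable (he : ∀ s t, e (s * t) = ((e s).1 * (e t).1, (e s).1 • (e t).2 + (e t).1 • (e s).2))

include he

theorem trivialExtension_map_one : e 1 = (1, 0) := by
  have h := he 1 (e.symm (1, 0))
  rw [one_mul, e.apply_symm_apply] at h
  have h1 : (e 1).1 = 1 := by simpa using (congrArg Prod.fst h).symm
  have h2 : (e 1).2 = 0 := by simpa using (congrArg Prod.snd h).symm
  exact Prod.ext h1 h2

theorem trivialExtension_map_algebraMap (a : A) : e (algebraMap A T a) = (a, 0) := by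
  rw [Algebra.algebraMap_eq_smul_one, map_smul, trivialExtension_map_one e he]
  simp

theorem isUnit_of_isUnit_fst {t : T} (ht : IsUnit (e t).1) : IsUnit t := by
  obtain ⟨u, hu⟩ := ht
  refine IsUnit.of_mul_eq_one (e.symm (↑u⁻¹, -((↑u⁻¹ : A) • (↑u⁻¹ : A) • (e t).2))) (e.injective ?_)
  rw [he, trivialExtension_map_one e he, e.apply_symm_apply, ← hu]
  refine Prod.ext (by simp) ?_
  simp [← mul_smul]

theorem isLocalRing_trivialExtension [IsLocalRing A] : IsLocalRing T := by
  have : Nontrivial T := e.toEquiv.nontrivial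
  refine IsLocalRing.of_is_unit_or_is_unit_of_add_one ?_
  intro a b hab
  have h : (e a).1 + (e b).1 = 1 := by
    rw [← Prod.fst_add, ← map_add, hab, trivialExtension_map_one e he]
  exact (IsLocalRing.isUnit_or_isUnit_of_add_one h).imp
    (isUnit_of_isUnit_fst e he) (isUnit_of_isUnit_fst e he)

theorem isLocalHom_algebraMap_trivialExtension : IsLocalHom (algebraMap A T) := by
  refine ⟨fun a ha => ?_⟩
  obtain ⟨t, ht⟩ := isUnit_iff_exists_inv.1 ha
  have h := he (algebraMap A T a) t
  rw [ht, trivialExtension_map_one e he, trivialExtension_map_algebraMap e he] at h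
  exact IsUnit.of_mul_eq_one _ (congrArg Prod.fst h).symm

end TrivialExtension

theorem smul_top_le_restrictScalars {R A N : Type} [CommRing R] [CommRing A] [Algebra R A]
    [AddCommGroup N] [Module R N] [Module A N] [IsScalarTower R A N] (I : Ideal R) :
    I • (⊤ : Submodule R N) ≤
      (I.map (algebraMap R A) • (⊤ : Submodule A N)).restrictScalars R :=
  Submodule.smul_le.2 fun r hr x _ => by
    rw [← algebraMap_smul A r x, Submodule.restrictScalars_mem]
    exact Submodule.smul_mem_smul (Ideal.mem_map_of_mem _ hr) Submodule.mem_top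

/-- The closed fibre of the trivial extension by the dualizing module is zero-dimensional
Gorenstein. -/
theorem closedFibre_trivialExtension {R A T E I : Type} [CommRing R] [IsLocalRing R]
    [IsNoetherianRing R] [CommRing A] [IsLocalRing A] [IsNoetherianRing A] [Algebra R A]
    [AddCommGroup E] [Module R E] [AddCommGroup I] [Module R I] [Module A I] [IsScalarTower R A I]
    [Module.Injective R I] [Module.Injective A I] {e₀ : E} {i₀ : I} (h0 : e₀ ≠ 0)
    (he₀ : ∀ r ∈ maximalIdeal R, r • e₀ = 0) (hE : ∀ y : E, y ≠ 0 → ∃ r : R, r • y = e₀)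
    (hi0 : i₀ ≠ 0) (hi₀ : ∀ r ∈ maximalIdeal A, r • i₀ = 0)
    (hI : ∀ y : I, y ≠ 0 → ∃ r : A, r • y = i₀) [Module.Finite A (E →ₗ[R] I)]
    (hfin : IsFiniteLength A (A ⧸ (maximalIdeal R).map (algebraMap R A)))
    [CommRing T] [Algebra A T] (e : T ≃ₗ[A] A × (E →ₗ[R] I))
    (he : ∀ s t, e (s * t) = ((e s).1 * (e t).1, (e s).1 • (e t).2 + (e t).1 • (e s).2)) :
    IsArtinianRing (T ⧸ (maximalIdeal R).map ((algebraMap A T).comp (algebraMap R A))) ∧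
    IsGorenstein (T ⧸ (maximalIdeal R).map ((algebraMap A T).comp (algebraMap R A))) := by
  rw [← Ideal.map_map]
  set J := (maximalIdeal R).map (algebraMap R A) with hJ
  set K := J.map (algebraMap A T) with hK
  let l : T →ₗ[A] I := evalAt R A I e₀ ∘ₗ LinearMap.snd A A _ ∘ₗ e.toLinearMap
  have hJ0 : ∀ a ∈ J, ∀ f : E →ₗ[R] I, a • f e₀ = 0 := by
    intro a ha f
    induction ha using Submodule.span_induction with
    | mem a ha =>
      obtain ⟨r, hr, rfl⟩ := ha
      rw [algebraMap_smul, ← map_smul, he₀ r hr, map_zero]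
    | zero => rw [zero_smul]
    | add a b _ _ ha hb => rw [add_smul, ha, hb, add_zero]
    | smul b a _ ha => rw [smul_assoc, ha, smul_zero]
  have hlK : ∀ t ∈ K, l t = 0 := by
    intro t ht
    suffices h : ∀ u, l (u * t) = 0 by simpa using h 1
    induction ht using Submodule.span_induction with
    | mem t ht =>
      obtain ⟨a, ha, rfl⟩ := ht
      intro u
      rw [mul_comm, ← Algebra.smul_def, map_smul]
      exact hJ0 a ha _
    | zero => simp
    | add s t _ _ hs ht => intro u; rw [mul_add, map_add, hs, ht, add_zero]
    | smul c t _ ht => intro u; rw [smul_eq_mul, ← mul_assoc, ht]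
  have hKl : ∀ s, (∀ t, l (s * t) = 0) → s ∈ K := by
    intro s hs
    have hs' : ∀ t, (e s).1 • (e t).2 e₀ + (e t).1 • (e s).2 e₀ = 0 := by
      intro t
      have := hs t
      change (e (s * t)).2 e₀ = 0 at this
      rwa [he] at this
    have hsnd : (e s).2 e₀ = 0 := by simpa [trivialExtension_map_one e he] using hs' 1
    have hfst : (e s).1 ∈ J := by
      by_contra hJs
      obtain ⟨g, hg⟩ := Module.Injective.exists_comp_eq
        (LinearMap.toSpanSingleton A (A ⧸ J) (Ideal.Quotient.mk J (e s).1))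
        (LinearMap.toSpanSingleton A I i₀) (fun r hr => by
          have hr : r • Ideal.Quotient.mk J (e s).1 = 0 := hr
          refine hi₀ r ((mem_maximalIdeal r).2 fun hu => hJs ?_)
          rwa [hu.smul_eq_zero, Ideal.Quotient.eq_zero_iff_mem] at hr)
      have hg1 : g (Ideal.Quotient.mk J (e s).1) = i₀ := by
        simpa using LinearMap.congr_fun hg 1
      obtain ⟨f, hf⟩ := exists_linearMap_apply_eq (R := R) (I := I) h0
        (i := g (Ideal.Quotient.mk J 1)) (fun r hr => by
          rw [← algebraMap_smul A r, ← map_smul]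
          change g (Ideal.Quotient.mk J (algebraMap R A r * 1)) = 0
          rw [mul_one, Ideal.Quotient.eq_zero_iff_mem.2 (Ideal.mem_map_of_mem _ hr), map_zero])
      have := hs' (e.symm (0, f))
      rw [e.apply_symm_apply, hf, ← map_smul, zero_smul, add_zero] at this
      change g (Ideal.Quotient.mk J ((e s).1 * 1)) = 0 at this
      rw [mul_one, hg1] at this
      exact hi0 this
    have hsm := smul_top_le_restrictScalars (A := A) (maximalIdeal R)
      (mem_maximalIdeal_smul_top_of_apply_eq_zero h0 hE _ hsnd)
    exact (trivialExtension_mem_map_iff e J).2 ⟨hfst, hsm⟩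
  have hKsmul : ∀ a ∈ J, ∀ x : T ⧸ K, a • x = 0 := by
    intro a ha x
    rw [Algebra.smul_def]
    have : algebraMap A (T ⧸ K) a = 0 := Ideal.Quotient.eq_zero_iff_mem.2 (Ideal.mem_map_of_mem _ ha)
    rw [this, zero_mul]
  have := (isFiniteLength_iff_isNoetherian_isArtinian.1 hfin).2
  have : Module.Finite A T := Module.Finite.equiv e.symm
  have hfinT : Module.Finite A (T ⧸ K) :=
    Module.Finite.of_surjective (Ideal.Quotient.mkₐ A K).toLinearMap Ideal.Quotient.mk_surjective
  have hart : IsArtinian A (T ⧸ K) := isArtinian_of_smul_eq_zero J hKsmul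
  refine ⟨isArtinian_of_tower A hart, isGorenstein_of_baer _ ?_⟩
  obtain ⟨g, hg⟩ := Module.Injective.exists_comp_eq (Ideal.Quotient.mkₐ A K).toLinearMap l
    (fun t ht => hlK t (Ideal.Quotient.eq_zero_iff_mem.1 ht))
  refine baer_of_nondegenerate hi0 hi₀ hI
    (isFiniteLength_iff_isNoetherian_isArtinian.2 ⟨inferInstance, hart⟩) g fun s hs => ?_
  obtain ⟨s, rfl⟩ := Ideal.Quotient.mk_surjective s
  refine Ideal.Quotient.eq_zero_iff_mem.2 (hKl s fun t => ?_)
  rw [← hg]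
  exact hs (Ideal.Quotient.mk K t)

end

section

open IsLocalRing RingTheory.Sequence TensorProduct

/-- Localizing and completing a deformation at a minimal prime of the closed fibre. -/
theorem exists_complete_deformation {R R' Q : Type} [CommRing R] [IsLocalRing R]
    [CommRing R'] [IsLocalRing R'] [CommRing Q] [IsNoetherianRing Q] [Algebra R R'] [Algebra Q R']
    [IsLocalHom (algebraMap R R')] (hS : Function.Surjective (algebraMap Q R')) :
    ∃ (Q₁ R₁ : Type) (_ : CommRing Q₁) (_ : CommRing R₁) (_ : IsNoetherianRing Q₁)
      (_ : IsNoetherianRing R₁) (_ : IsLocalRing Q₁) (_ : IsLocalRing R₁) (_ : Algebra Q Q₁)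
      (_ : Algebra Q₁ R₁) (_ : Algebra R' R₁),
      (algebraMap Q₁ R₁).comp (algebraMap Q Q₁) = (algebraMap R' R₁).comp (algebraMap Q R') ∧
      Function.Surjective (algebraMap Q₁ R₁) ∧
      RingHom.ker (algebraMap Q₁ R₁) =
        (RingHom.ker (algebraMap Q R')).map (algebraMap Q Q₁) ∧
      Module.Flat R' R₁ ∧ Module.Flat Q Q₁ ∧
      RingHom.ker (algebraMap Q₁ R₁) ≤ maximalIdeal Q₁ ∧
      IsPrecomplete (maximalIdeal Q₁) Q₁ ∧ IsPrecomplete (maximalIdeal R₁) R₁ ∧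
      IsLocalHom ((algebraMap R' R₁).comp (algebraMap R R')) ∧
      ∃ c : ℕ, maximalIdeal R₁ ^ c ≤
        (maximalIdeal R).map ((algebraMap R' R₁).comp (algebraMap R R')) := by
  set m := (maximalIdeal R).map (algebraMap R R') with hm
  have hm1 : m ≠ ⊤ := by
    have : m ≤ maximalIdeal R' := ((local_hom_TFAE (algebraMap R R')).out 0 2).1 ‹_›
    exact fun h => (maximalIdeal.isMaximal R').ne_top (top_le_iff.1 (h ▸ this))
  obtain ⟨q, hq⟩ := Ideal.nonempty_minimalPrimes
    (I := m.comap (algebraMap Q R')) (Ideal.comap_ne_top _ hm1)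
  have := hq.1.1
  obtain ⟨Q₁, _, _, _, _, hflat, hcomp, hmax, hcomap⟩ := exists_flat_isAdicComplete Q q
  let _ : Algebra Q₁ (R' ⊗[Q] Q₁) := Algebra.TensorProduct.rightAlgebra
  have hsurj : Function.Surjective (algebraMap Q₁ (R' ⊗[Q] Q₁)) := fun z => by
    obtain ⟨a, rfl⟩ := exists_eq_one_tmul hS z
    exact ⟨a, rfl⟩
  have hker : RingHom.ker (algebraMap Q₁ (R' ⊗[Q] Q₁)) =
      (RingHom.ker (algebraMap Q R')).map (algebraMap Q Q₁) := by
    ext a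
    refine (one_tmul_eq_zero_iff hS rfl a).trans ?_
    rw [Ideal.smul_top_eq_map]
    rfl
  have hqle : m.comap (algebraMap Q R') ≤ q := hq.1.2
  have hqmap : ∀ I : Ideal Q, I ≤ q → I.map (algebraMap Q Q₁) ≤ maximalIdeal Q₁ :=
    fun I hI => (Ideal.map_mono hI).trans_eq hmax.symm
  have hkerm : RingHom.ker (algebraMap Q₁ (R' ⊗[Q] Q₁)) ≤ maximalIdeal Q₁ := by
    rw [hker]
    exact hqmap _ (le_trans (fun x hx => by
      rw [Ideal.mem_comap, RingHom.mem_ker.1 hx]; exact zero_mem _) hqle)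
  have : Nontrivial (R' ⊗[Q] Q₁) := by
    refine ⟨1, 0, fun h => ?_⟩
    rw [← map_one (algebraMap Q₁ (R' ⊗[Q] Q₁))] at h
    exact (maximalIdeal.isMaximal Q₁).ne_top ((Ideal.eq_top_iff_one _).2 (hkerm h))
  have : IsLocalRing (R' ⊗[Q] Q₁) := IsLocalRing.of_surjective' _ hsurj
  have hnoeth := isNoetherianRing_of_surjective _ _ (algebraMap Q₁ (R' ⊗[Q] Q₁)) hsurj
  have hcomm : (algebraMap Q₁ (R' ⊗[Q] Q₁)).comp (algebraMap Q Q₁) =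
      (algebraMap R' (R' ⊗[Q] Q₁)).comp (algebraMap Q R') := by
    ext x
    exact (Algebra.TensorProduct.tmul_one_eq_one_tmul x).symm
  have hmax₁ : maximalIdeal (R' ⊗[Q] Q₁) =
      (maximalIdeal Q₁).map (algebraMap Q₁ (R' ⊗[Q] Q₁)) :=
    (map_maximalIdeal_of_surjective _ hsurj).symm
  have hmR : (maximalIdeal R).map ((algebraMap R' (R' ⊗[Q] Q₁)).comp (algebraMap R R')) =
      ((m.comap (algebraMap Q R')).map (algebraMap Q Q₁)).map
        (algebraMap Q₁ (R' ⊗[Q] Q₁)) := by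
    rw [Ideal.map_map, hcomm, ← Ideal.map_map, ← Ideal.map_map,
      Ideal.map_comap_of_surjective _ hS]
  refine ⟨Q₁, R' ⊗[Q] Q₁, inferInstance, inferInstance, inferInstance, hnoeth, inferInstance,
    inferInstance, inferInstance, inferInstance, inferInstance, hcomm, hsurj, hker, inferInstance,
    hflat, hkerm, inferInstance, ?_, ?_, ?_⟩
  · rw [hmax₁]
    exact isPrecomplete_map_of_surjective _ hsurj _
  · refine ((local_hom_TFAE _).out 0 2).2 ?_
    rw [hmR, hmax₁]
    exact Ideal.map_mono (hqmap _ hqle)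
  · have hrad : maximalIdeal Q₁ ≤ ((m.comap (algebraMap Q R')).map (algebraMap Q Q₁)).radical := by
      rw [Ideal.radical_eq_sInf]
      refine le_sInf fun P hP => ?_
      have := hP.2
      rw [hmax, Ideal.map_le_iff_le_comap]
      refine hq.2 ⟨Ideal.comap_isPrime _ _, Ideal.map_le_iff_le_comap.1 hP.1⟩ ?_
      rw [← hcomap]
      exact Ideal.comap_mono (le_maximalIdeal hP.2.ne_top)
    obtain ⟨c, hc⟩ := Ideal.exists_pow_le_of_le_radical_of_fg hrad (IsNoetherian.noetherian _)
    refine ⟨c, ?_⟩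
    rw [hmax₁, ← Ideal.map_pow, hmR]
    exact Ideal.map_mono hc

end

section

open IsLocalRing RingTheory.Sequence

theorem Module.Flat.pi_fin {R M : Type} [CommRing R] [AddCommGroup M] [Module R M]
    [Module.Flat R M] (b : ℕ) : Module.Flat R (Fin b → M) :=
  Module.Flat.of_linearEquiv (DFinsupp.linearEquivFunOnFintype (R := R) (M := fun _ : Fin b => M)).symm

theorem Module.Flat.prod {R M N : Type} [CommRing R] [AddCommGroup M] [Module R M]
    [AddCommGroup N] [Module R N] [Module.Flat R M] [Module.Flat R N] : Module.Flat R (M × N) := by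
  rw [Module.Flat.iff_rTensor_preserves_injective_linearMap]
  intro P Q _ _ _ _ f hf
  have h : (TensorProduct.prodRight R R Q M N).toLinearMap ∘ₗ f.rTensor (M × N) =
      (f.rTensor M).prodMap (f.rTensor N) ∘ₗ (TensorProduct.prodRight R R P M N).toLinearMap := by
    ext <;> simp
  have hinj : Function.Injective ((TensorProduct.prodRight R R Q M N).toLinearMap ∘ₗ f.rTensor (M × N)) := by
    rw [h]
    exact (Function.Injective.prodMap (Module.Flat.rTensor_preserves_injective_linearMap f hf)
      (Module.Flat.rTensor_preserves_injective_linearMap f hf)).comp (LinearEquiv.injective _)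
  exact Function.Injective.of_comp hinj

theorem isFiniteLength_quotient_of_pow_le {A : Type} [CommRing A] [IsLocalRing A]
    [IsNoetherianRing A] {J : Ideal A} (hJ : J ≤ maximalIdeal A) {c : ℕ}
    (hc : maximalIdeal A ^ c ≤ J) : IsFiniteLength A (A ⧸ J) := by
  have : Nontrivial (A ⧸ J) := Ideal.Quotient.nontrivial_iff.2
    fun h => (maximalIdeal.isMaximal A).ne_top (top_le_iff.1 (h ▸ hJ))
  have : IsLocalRing (A ⧸ J) := .of_surjective' _ Ideal.Quotient.mk_surjective
  have hart : IsArtinianRing (A ⧸ J) := by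
    refine (isArtinianRing_iff_isNilpotent_maximalIdeal _).2 ⟨c, ?_⟩
    rw [← map_maximalIdeal_of_surjective _ (Ideal.Quotient.mk_surjective (I := J)), ← Ideal.map_pow,
      Ideal.zero_eq_bot, Ideal.map_eq_bot_iff_le_ker, Ideal.mk_ker]
    exact hc
  have : IsArtinian A (A ⧸ J) :=
    isArtinian_of_surjective_algebraMap (Ideal.Quotient.mk_surjective (I := J))
  exact isFiniteLength_iff_isNoetherian_isArtinian.2 ⟨inferInstance, this⟩

theorem exists_gorenstein_trivialExtension {R A S : Type} [CommRing R] [IsLocalRing R]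
    [IsNoetherianRing R] [CommRing A] [IsLocalRing A] [IsNoetherianRing A] [CommRing S]
    [IsLocalRing S] [IsNoetherianRing S] [Algebra R A] [Algebra S A] [Module.Flat R A]
    [IsLocalHom (algebraMap R A)] [IsPrecomplete (maximalIdeal A) A]
    [IsPrecomplete (maximalIdeal S) S] (hS : Function.Surjective (algebraMap S A)) {xs : List S}
    (hker : RingHom.ker (algebraMap S A) = Ideal.ofList xs) (hxs : IsWeaklyRegular S xs)
    (hm : ∀ x ∈ xs, x ∈ maximalIdeal S)
    {c : ℕ} (hc : maximalIdeal A ^ c ≤ (maximalIdeal R).map (algebraMap R A)) :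
    ∃ (T U : Type) (_ : CommRing T) (_ : CommRing U) (_ : IsNoetherianRing T)
      (_ : IsNoetherianRing U) (_ : IsLocalRing T) (_ : IsLocalRing U) (_ : Algebra S T)
      (_ : Algebra A U) (τ : T →+* U),
      τ.comp (algebraMap S T) = (algebraMap A U).comp (algebraMap S A) ∧
      Function.Surjective τ ∧
      RingHom.ker τ = (Ideal.ofList xs).map (algebraMap S T) ∧
      IsWeaklyRegular T xs ∧ IsLocalHom (algebraMap S T) ∧
      IsLocalHom ((algebraMap A U).comp (algebraMap R A)) ∧
      ((algebraMap A U).comp (algebraMap R A)).Flat ∧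
      IsArtinianRing (U ⧸ (maximalIdeal R).map ((algebraMap A U).comp (algebraMap R A))) ∧
      IsGorenstein (U ⧸ (maximalIdeal R).map ((algebraMap A U).comp (algebraMap R A))) := by
  obtain ⟨E, _, _, e₀, _, h0, he₀, hE⟩ := exists_injectiveHull R
  obtain ⟨I, _, _, i₀, _, hi0, hi₀, hI⟩ := exists_injectiveHull A
  let _ : Module R I := Module.compHom I (algebraMap R A)
  have : IsScalarTower R A I := IsScalarTower.of_algebraMap_smul fun _ _ => rfl
  have : Module.Injective R I := Module.Injective.of_flat_restrictScalars (R₁ := A)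
  have hfin : IsFiniteLength A (A ⧸ (maximalIdeal R).map (algebraMap R A)) := by
    refine isFiniteLength_quotient_of_pow_le ?_ hc
    exact ((local_hom_TFAE (algebraMap R A)).out 0 2).1 ‹IsLocalHom (algebraMap R A)›
  have := finite_linearMap h0 he₀ hE hi0 hi₀ hI hfin hc
  have := flat_linearMap_of_injective (R := R) (E := E) (I := I)
  let _ : Module S (E →ₗ[R] I) := Module.compHom _ (algebraMap S A)
  have : IsScalarTower S A (E →ₗ[R] I) := IsScalarTower.of_algebraMap_smul fun _ _ => rfl
  obtain ⟨D, _, _, π, _, hπ, hπker, hD⟩ := exists_deformation (D := E →ₗ[R] I) hS hker hxs hm (by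
    intro b c d p hp hpd f
    have := Module.Flat.pi_fin (R := R) (M := A) b
    refine exists_linearMap_extension d ?_ f
    rw [← hpd]
    exact Module.Flat.of_linearEquiv ((p.quotKerEquivOfSurjective hp).restrictScalars R))
  obtain ⟨T, _, _, e, he⟩ := exists_trivialExtension S D
  obtain ⟨U, _, _, e', he'⟩ := exists_trivialExtension A (E →ₗ[R] I)
  have : Module.Finite S T := Module.Finite.equiv e.symm
  have : Module.Finite A U := Module.Finite.equiv e'.symm
  have hloc := isLocalHom_algebraMap_trivialExtension e' he'
  let τ : T →+* U :=
    { toFun t := e'.symm (algebraMap S A (e t).1, π (e t).2)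
      map_one' := by
        rw [trivialExtension_map_one e he, map_one, map_zero, ← trivialExtension_map_one e' he',
          e'.symm_apply_apply]
      map_mul' s t := by
        apply e'.injective
        rw [he', e'.apply_symm_apply, e'.apply_symm_apply, e'.apply_symm_apply, he]
        simp
      map_zero' := by simp
      map_add' s t := by rw [← map_add]; simp }
  have hτ : ∀ t, τ t = e'.symm (algebraMap S A (e t).1, π (e t).2) := fun t => rfl
  obtain ⟨hart, hgor⟩ := closedFibre_trivialExtension h0 he₀ hE hi0 hi₀ hI hfin e' he'
  refine ⟨T, U, inferInstance, inferInstance, IsNoetherianRing.of_finite S T,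
    IsNoetherianRing.of_finite A U, isLocalRing_trivialExtension e he,
    isLocalRing_trivialExtension e' he', inferInstance, inferInstance, τ, ?_, ?_, ?_,
    (e.isWeaklyRegular_congr xs).2 (hxs.prod hD),
    isLocalHom_algebraMap_trivialExtension e he, inferInstance, ?_, hart, hgor⟩
  · ext x
    rw [RingHom.comp_apply, RingHom.comp_apply, hτ, trivialExtension_map_algebraMap e he,
      LinearEquiv.symm_apply_eq, trivialExtension_map_algebraMap e' he']
    simp
  · intro u
    obtain ⟨a, ha⟩ := hS (e' u).1
    obtain ⟨f, hf⟩ := hπ (e' u).2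
    exact ⟨e.symm (a, f), by rw [hτ, e.apply_symm_apply, ha, hf]; simp⟩
  · ext t
    rw [trivialExtension_mem_map_iff e, ← hπker, ← hker, RingHom.mem_ker, hτ,
      LinearEquiv.map_eq_zero_iff, Prod.mk_eq_zero]
    rfl
  · let _ := ((algebraMap A U).comp (algebraMap R A)).toAlgebra
    have : IsScalarTower R A U := IsScalarTower.of_algebraMap_eq' rfl
    have := Module.Flat.prod (R := R) (M := A) (N := E →ₗ[R] I)
    exact Module.Flat.of_linearEquiv (e'.restrictScalars R)

end

section

open IsLocalRing TensorProduct RingTheory.Sequence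

theorem smulCommClass_of_algebra {R Q A : Type} [CommRing R] [CommRing Q] [CommRing A]
    [Algebra R A] [Algebra Q A] : SMulCommClass R Q A :=
  ⟨fun r q a => by simp only [Algebra.smul_def]; ring⟩

theorem hasFiniteProjectiveDimension_baseChangeAsQModule_iff {R R' Q : Type} [CommRing R]
    [CommRing R'] [CommRing Q] (φ : R →+* R') (τ : Q →+* R') [Algebra R R'] [Algebra Q R']
    [SMulCommClass R Q R'] [SMulCommClass Q R R'] (hφ : ‹Algebra R R'› = φ.toAlgebra)
    (hτ : algebraMap Q R' = τ) (M : Type) [AddCommGroup M] [Module R M] :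
    HasFiniteProjectiveDimension Q (baseChangeAsQModule R R' Q φ τ M) ↔
    ∃ n : ℕ, HasProjectiveDimensionLE (ModuleCat.of Q (R' ⊗[R] M)) n := by
  subst hφ hτ
  rw [hasFiniteProjectiveDimension_iff]
  let _ := φ.toAlgebra
  let e : baseChangeAsQModule R R' Q φ (algebraMap Q R') M ≃ₗ[Q]
      ModuleCat.of Q (R' ⊗[R] M) :=
    { AddEquiv.refl (R' ⊗[R] M) with
      map_smul' := fun q x => (algebraMap_smul (M := R' ⊗[R] M) R' q x :) }
  exact exists_congr fun n => ⟨fun h => ModuleCat.hasProjectiveDimensionLE_of_linearEquiv e n,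
    fun h => ModuleCat.hasProjectiveDimensionLE_of_linearEquiv e.symm n⟩

end

/-- A finitely generated module of finite CI-dimension admits a quasi-deformation
witnessing this in which the closed fibre `R' ⧸ m R'` is artinian and Gorenstein. -/
theorem exists_quasiDeformation_with_gorenstein_closed_fibre
    (R : Type) [CommRing R] [IsNoetherianRing R] [IsLocalRing R]
    (M : Type) [AddCommGroup M] [Module R M] [Module.Finite R M]
    (hM : HasFiniteCIDimension R M) :
    ∃ (R' Q : Type) (_ : CommRing R') (_ : CommRing Q)
      (_ : IsNoetherianRing R') (_ : IsNoetherianRing Q)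
      (_ : IsLocalRing R') (_ : IsLocalRing Q)
      (φ : R →+* R') (τ : Q →+* R'),
        IsQuasiDeformation R R' Q φ τ ∧
          HasFiniteProjectiveDimension Q (baseChangeAsQModule R R' Q φ τ M) ∧
          IsArtinianRing (R' ⧸ (IsLocalRing.maximalIdeal R).map φ) ∧
          IsGorenstein (R' ⧸ (IsLocalRing.maximalIdeal R).map φ) := by
  obtain ⟨R', Q, _, _, _, _, _, _, φ, τ, ⟨hφ, -, hflat, hsurj, rs, hrs, hker⟩, hpd⟩ := hM
  let _ : Algebra R R' := φ.toAlgebra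
  let _ : Algebra Q R' := τ.toAlgebra
  have : Module.Flat R R' := hflat
  have : IsLocalHom (algebraMap R R') := hφ
  have := smulCommClass_of_algebra (R := R) (Q := Q) (A := R')
  have := smulCommClass_of_algebra (R := Q) (Q := R) (A := R')
  obtain ⟨n, hn⟩ := (hasFiniteProjectiveDimension_baseChangeAsQModule_iff φ τ rfl rfl M).1 hpd
  have hker' : RingHom.ker (algebraMap Q R') = Ideal.ofList rs := hker
  obtain ⟨Q₁, R₁, _, _, _, _, _, _, _, _, _, hcomm, hsurj₁, hker₁, _, _, hle, _, _, hloc, c, hc⟩ :=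
    exists_complete_deformation (R := R) (R' := R') (Q := Q) hsurj
  let _ : Algebra R R₁ := ((algebraMap R' R₁).comp (algebraMap R R')).toAlgebra
  have : IsScalarTower R R' R₁ := IsScalarTower.of_algebraMap_eq' rfl
  have : Module.Flat R R₁ := Module.Flat.trans R R' R₁
  have : IsLocalHom (algebraMap R R₁) := hloc
  rw [hker', Ideal.map_ofList] at hker₁
  have hrs₁ : RingTheory.Sequence.IsWeaklyRegular Q₁ (rs.map (algebraMap Q Q₁)) :=
    hrs.toIsWeaklyRegular.of_flat
  have hm₁ : ∀ x ∈ rs.map (algebraMap Q Q₁), x ∈ IsLocalRing.maximalIdeal Q₁ := fun x hx =>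
    hle (hker₁ ▸ Ideal.subset_span hx)
  obtain ⟨T, U, _, _, _, _, _, _, _, _, σ, hσcomm, hσ, hσker, hreg, _, hlocU, hflatU, hart, hgor⟩ :=
    exists_gorenstein_trivialExtension (R := R) (A := R₁) (S := Q₁) hsurj₁ hker₁ hrs₁ hm₁ hc
  let ψ : R →+* U := (algebraMap R₁ U).comp (algebraMap R R₁)
  let _ : Algebra R U := ψ.toAlgebra
  let _ : Algebra T U := σ.toAlgebra
  let _ : Algebra R' U := ((algebraMap R₁ U).comp (algebraMap R' R₁)).toAlgebra
  let _ : Algebra Q T := ((algebraMap Q₁ T).comp (algebraMap Q Q₁)).toAlgebra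
  let _ : Algebra Q U := (σ.comp (algebraMap Q T)).toAlgebra
  have : Module.Flat R U := hflatU
  have : IsScalarTower R R' U := IsScalarTower.of_algebraMap_eq' rfl
  have : IsScalarTower Q T U := IsScalarTower.of_algebraMap_eq' rfl
  have : IsScalarTower Q R' U := IsScalarTower.of_algebraMap_eq' (by
    change (σ.comp ((algebraMap Q₁ T).comp (algebraMap Q Q₁))) =
      ((algebraMap R₁ U).comp (algebraMap R' R₁)).comp (algebraMap Q R')
    rw [← RingHom.comp_assoc, hσcomm, RingHom.comp_assoc, hcomm, RingHom.comp_assoc])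
  set ys := (rs.map (algebraMap Q Q₁)).map (algebraMap Q₁ T) with hys
  have hσker' : RingHom.ker (algebraMap T U) = Ideal.ofList ys := by
    rw [hys, ← Ideal.map_ofList]
    exact hσker
  have : Algebra.IsPushout Q R' T U := by
    refine isPushout_of_surjective hsurj hσ ?_
    rw [hσker', hker', Ideal.map_ofList, hys, List.map_map]
    rfl
  have hTreg : RingTheory.Sequence.IsWeaklyRegular T rs := by
    rw [← RingTheory.Sequence.isWeaklyRegular_map_algebraMap_iff T T] at hreg ⊢
    rwa [List.map_map] at hreg
  have hysreg : RingTheory.Sequence.IsWeaklyRegular T ys :=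
    (RingTheory.Sequence.isWeaklyRegular_map_algebraMap_iff T T _).2 hreg
  have hysm : ∀ y ∈ ys, y ∈ IsLocalRing.maximalIdeal T := by
    intro y hy
    obtain ⟨x, hx, rfl⟩ := List.mem_map.1 hy
    exact map_nonunit (algebraMap Q₁ T) x (hm₁ x hx)
  have := smulCommClass_of_algebra (R := R) (Q := T) (A := U)
  have := smulCommClass_of_algebra (R := T) (Q := R) (A := U)
  refine ⟨U, T, inferInstance, inferInstance, inferInstance, inferInstance, inferInstance,
    inferInstance, ψ, σ, ⟨hlocU, hσ.isLocalHom, hflatU, hσ, ys,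
      .of_isWeaklyRegular_of_mem_maximalIdeal _ hysm hysreg, hσker'⟩,
    (hasFiniteProjectiveDimension_baseChangeAsQModule_iff ψ σ rfl rfl M).2 ⟨n, ?_⟩, hart, hgor⟩
  exact hasProjectiveDimensionLE_of_isPushout hsurj hker' hrs.toIsWeaklyRegular hTreg M n hn
end

section
/- (Happel) Let k be an algebraically closed field and R a finite-dimensional commutative k-algebra. For each n ∈ ℕ, the set of isomorphism classes of R-modules N such that Ext^1_R(N, N) = 0 and len_R(N) = n is finite. -/
/-!
STATEMENT 19 (Happel): Over a finite-dimensional commutative algebra R over an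
algebraically closed field k, for each n there are only finitely many isomorphism
classes of R-modules N with Ext^1_R(N, N) = 0 and len_R(N) = n.
-/

open CategoryTheory

/-- The length of an `R`-module, encoded as the Krull dimension of its lattice of
submodules. -/
noncomputable def moduleLength (R : Type) [CommRing R] (M : Type) [AddCommGroup M]
    [Module R M] : WithBot ℕ∞ :=
  Order.krullDim (Submodule R M)

/-- A family of vectors is regular with respect to an algebra `S` of functions if all its
coordinates belong to `S`. -/
def IsRegularFamily {k X W : Type*} [Field k] [AddCommGroup W] [Module k W]
    (S : Subalgebra k (X → k)) (f : X → W) : Prop :=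
  ∀ l : Module.Dual k W, (fun y => l (f y)) ∈ S

namespace IsRegularFamily

variable {k X W W₁ W₂ : Type*} [Field k] [AddCommGroup W] [Module k W]
  [AddCommGroup W₁] [Module k W₁] [AddCommGroup W₂] [Module k W₂] {S : Subalgebra k (X → k)}

theorem const (w : W) : IsRegularFamily S (fun _ => w) :=
  fun l => S.algebraMap_mem (l w)

theorem add {f g : X → W} (hf : IsRegularFamily S f) (hg : IsRegularFamily S g) :
    IsRegularFamily S (fun y => f y + g y) := fun l => by
  simp only [map_add]
  exact S.add_mem (hf l) (hg l)

theorem sub {f g : X → W} (hf : IsRegularFamily S f) (hg : IsRegularFamily S g) :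
    IsRegularFamily S (fun y => f y - g y) := fun l => by
  simp only [map_sub]
  exact S.sub_mem (hf l) (hg l)

theorem map {f : X → W} (hf : IsRegularFamily S f) (L : W →ₗ[k] W₁) :
    IsRegularFamily S (fun y => L (f y)) := fun l => hf (l ∘ₗ L)

theorem of_basis {ι : Type*} [Fintype ι] (b : Module.Basis ι k W) {f : X → W}
    (h : ∀ i, (fun y => b.repr (f y) i) ∈ S) : IsRegularFamily S f := fun l => by
  have : (fun y => l (f y)) = ∑ i, l (b i) • fun y => b.repr (f y) i := by
    ext y
    conv_lhs => rw [← b.sum_repr (f y)]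
    simp [-Module.Basis.sum_repr, mul_comm]
  rw [this]
  exact S.sum_mem fun i _ => S.smul_mem (h i) _

theorem bilin [FiniteDimensional k W₁] {f : X → W₁} {g : X → W₂}
    (hf : IsRegularFamily S f) (hg : IsRegularFamily S g) (B : W₁ →ₗ[k] W₂ →ₗ[k] W) :
    IsRegularFamily S (fun y => B (f y) (g y)) := fun l => by
  let b := Module.finBasis k W₁
  have : (fun y => l (B (f y) (g y))) =
      ∑ i, (fun y => b.coord i (f y)) * fun y => (l ∘ₗ B (b i)) (g y) := by
    ext y
    conv_lhs => rw [← b.sum_repr (f y)]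
    simp [-Module.Basis.sum_repr]
  rw [this]
  exact S.sum_mem fun i _ => S.mul_mem (hf _) (hg _)

theorem exists_matrix {ι : Type*} [Fintype ι] [DecidableEq ι] {A : X → Matrix ι ι k}
    (hA : ∀ i j, (fun y => A y i j) ∈ S) :
    ∃ M : Matrix ι ι S, ∀ y, ((Pi.evalRingHom (fun _ : X => k) y).comp S.val.toRingHom).mapMatrix M
      = A y :=
  ⟨fun i j => ⟨_, hA i j⟩, fun _ => rfl⟩

variable {g : X → Module.End k W}

theorem toMatrix {ι : Type*} [Fintype ι] [DecidableEq ι] (b : Module.Basis ι k W)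
    (hg : IsRegularFamily S g) (i j : ι) :
    (fun y => LinearMap.toMatrix b b (g y) i j) ∈ S := by
  simpa [LinearMap.toMatrix_apply] using hg (b.coord i ∘ₗ LinearMap.applyₗ (b j))

theorem det [FiniteDimensional k W] (hg : IsRegularFamily S g) :
    (fun y => LinearMap.det (g y)) ∈ S := by
  let b := Module.finBasis k W
  obtain ⟨M, hM⟩ := exists_matrix (hg.toMatrix b)
  convert M.det.2 with y
  rw [← LinearMap.det_toMatrix b, ← hM, ← RingHom.map_det]
  rfl

theorem exists_adjugate [FiniteDimensional k W] (hg : IsRegularFamily S g) :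
    ∃ a : X → Module.End k W, IsRegularFamily S a ∧ ∀ y w,
      a y (g y w) = LinearMap.det (g y) • w := by
  let b := Module.finBasis k W
  obtain ⟨M, hM⟩ := exists_matrix (hg.toMatrix b)
  refine ⟨fun y => Matrix.toLin b b (LinearMap.toMatrix b b (g y)).adjugate, ?_, fun y w => ?_⟩
  · refine IsRegularFamily.map (of_basis (Matrix.stdBasis k _ _) fun ij => ?_)
      (Matrix.toLin b b).toLinearMap
    convert (M.adjugate ij.1 ij.2).2 with y
    rw [← hM, ← RingHom.map_adjugate]
    simp [Matrix.stdBasis]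
  · have h : Matrix.toLin b b (LinearMap.toMatrix b b (g y)).adjugate ∘ₗ g y =
        LinearMap.det (g y) • LinearMap.id := by
      apply (LinearMap.toMatrix b b).injective
      rw [LinearMap.toMatrix_comp b b b, LinearMap.toMatrix_toLin, Matrix.adjugate_mul, map_smul,
        LinearMap.toMatrix_id, LinearMap.det_toMatrix]
    exact LinearMap.congr_fun h w

end IsRegularFamily

theorem exists_finite_set_of_finite_codomain {α β : Type*} [Finite β] (c : α → β) :
    ∃ T : Set α, T.Finite ∧ ∀ x, ∃ z ∈ T, c x = c z :=
  ⟨Set.range (Set.rangeSplitting c), Set.finite_range _, fun x =>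
    ⟨_, ⟨⟨c x, x, rfl⟩, rfl⟩, (Set.apply_rangeSplitting c ⟨c x, x, rfl⟩).symm⟩⟩

theorem LinearMap.exists_homotopy_of_exact {k C₀ C₁ C₂ : Type*} [Field k]
    [AddCommGroup C₀] [Module k C₀] [AddCommGroup C₁] [Module k C₁] [AddCommGroup C₂] [Module k C₂]
    (f : C₀ →ₗ[k] C₁) (g : C₁ →ₗ[k] C₂) (h : Function.Exact f g) :
    ∃ (s : C₁ →ₗ[k] C₀) (t : C₂ →ₗ[k] C₁), f ∘ₗ s + t ∘ₗ g = LinearMap.id := by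
  obtain ⟨q, hq⟩ := g.rangeRestrict.exists_rightInverse_of_surjective g.range_rangeRestrict
  obtain ⟨t, ht⟩ := q.exists_extend
  obtain ⟨r, hr⟩ := f.rangeRestrict.exists_rightInverse_of_surjective f.range_rangeRestrict
  have hgt (x) : g (t (g x)) = g x := by
    have h1 : t (g x) = q (g.rangeRestrict x) := LinearMap.congr_fun ht (g.rangeRestrict x)
    rw [h1]
    exact congr(($hq (g.rangeRestrict x) : C₂))
  let p : C₁ →ₗ[k] LinearMap.range f := (LinearMap.id - t ∘ₗ g).codRestrict _ fun x =>
    (h _).1 (by simp [hgt])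
  refine ⟨r ∘ₗ p, t, LinearMap.ext fun x => ?_⟩
  have h2 : f (r (p x)) = x - t (g x) := congr(($hr (p x) : C₁))
  simp [h2]

namespace AlgHom

variable {k R E : Type*} [Field k] [CommRing R] [Algebra k R] [Ring E] [Algebra k E]

/-- The linear maps `e ↦ (r ↦ φ r * e)`. -/
def leftDiff₀ : (R →ₗ[k] E) →ₗ[k] E →ₗ[k] R →ₗ[k] E :=
  LinearMap.mk₂ k (fun φ e => LinearMap.mulRight k e ∘ₗ φ)
    (fun _ _ _ => by ext; simp [add_mul]) (fun _ _ _ => by ext; simp)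
    (fun _ _ _ => by ext; simp [mul_add]) (fun _ _ _ => by ext; simp)

/-- The linear maps `θ ↦ ((r, s) ↦ φ r * θ s)`. -/
def leftDiff₁ : (R →ₗ[k] E) →ₗ[k] (R →ₗ[k] E) →ₗ[k] R →ₗ[k] R →ₗ[k] E :=
  LinearMap.mk₂ k (fun φ θ => (LinearMap.mul k E).compl₁₂ φ θ)
    (fun _ _ _ => by ext; simp) (fun _ _ _ => by ext; simp)
    (fun _ _ _ => by ext; simp [mul_add]) (fun _ _ _ => by ext; simp)

/-- The Hochschild coboundary in degree zero, with coefficients in `E` viewed as a bimodule via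
`y` on the left and `x` on the right. -/
def diff₀ (x : R →ₐ[k] E) (y : R →ₗ[k] E) : E →ₗ[k] R →ₗ[k] E :=
  leftDiff₀ y - LinearMap.mk₂ k (fun e r => e * x r)
    (by simp [add_mul]) (by simp) (by simp [mul_add]) (by simp)

/-- The Hochschild coboundary in degree one, with coefficients in `E` viewed as a bimodule via
`y` on the left and `x` on the right. -/
def diff₁ (x : R →ₐ[k] E) (y : R →ₗ[k] E) : (R →ₗ[k] E) →ₗ[k] R →ₗ[k] R →ₗ[k] E :=
  leftDiff₁ y + LinearMap.mk₂ k
    (fun θ r => LinearMap.mulLeft k (θ r) ∘ₗ x.toLinearMap - θ ∘ₗ LinearMap.mulLeft k r)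
    (fun _ _ _ => by ext; simp [add_mul]; abel) (fun _ _ _ => by ext; simp [smul_sub])
    (fun _ _ _ => by ext; simp [add_mul]; abel) (fun _ _ _ => by ext; simp [smul_sub])

theorem diff₀_apply (x : R →ₐ[k] E) (y : R →ₗ[k] E) (e : E) (r : R) :
    diff₀ x y e r = y r * e - e * x r := by
  simp [diff₀, leftDiff₀]

theorem diff₁_apply (x : R →ₐ[k] E) (y : R →ₗ[k] E) (θ : R →ₗ[k] E) (r s : R) :
    diff₁ x y θ r s = y r * θ s + (θ r * x s - θ (r * s)) := by
  simp [diff₁, leftDiff₁]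

theorem diff₁_diff₀ (x y : R →ₐ[k] E) (e : E) : diff₁ x y (diff₀ x y e) = 0 := by
  ext r s
  simp [diff₁_apply, diff₀_apply, mul_sub, sub_mul, mul_assoc]

/-- An algebra homomorphism is rigid if every derivation with values in its target is inner. -/
def IsRigid (x : R →ₐ[k] E) : Prop :=
  ∀ φ : R →ₗ[k] E, (∀ r s, φ (r * s) = x r * φ s + φ r * x s) → ∃ e, ∀ r, φ r = x r * e - e * x r

/-- The coordinate algebra of the space of algebra homomorphisms `R →ₐ[k] E`, as an algebra of
functions. -/
def coordinateAlgebra (k R E : Type*) [Field k] [CommRing R] [Algebra k R] [Ring E] [Algebra k E] :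
    Subalgebra k ((R →ₐ[k] E) → k) :=
  Algebra.adjoin k (Set.range fun (l : Module.Dual k (R →ₗ[k] E)) (y : R →ₐ[k] E) =>
    l y.toLinearMap)

theorem isRegularFamily_toLinearMap :
    IsRegularFamily (coordinateAlgebra k R E) (fun y => y.toLinearMap) :=
  fun l => Algebra.subset_adjoin ⟨l, rfl⟩

theorem coordinateAlgebra_isNoetherianRing [FiniteDimensional k R] [FiniteDimensional k E] :
    IsNoetherianRing (coordinateAlgebra k R E) := by
  let b := Module.finBasis k (R →ₗ[k] E)
  let s : Set ((R →ₐ[k] E) → k) := Set.range fun i y => b.repr y.toLinearMap i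
  have hreg : IsRegularFamily (Algebra.adjoin k s) (fun y : R →ₐ[k] E => y.toLinearMap) :=
    .of_basis b fun i => Algebra.subset_adjoin ⟨i, rfl⟩
  have heq : coordinateAlgebra k R E = Algebra.adjoin k s := by
    refine le_antisymm (Algebra.adjoin_le ?_) (Algebra.adjoin_mono ?_)
    · rintro _ ⟨l, rfl⟩
      exact hreg l
    · rintro _ ⟨i, rfl⟩
      exact ⟨b.coord i, rfl⟩
  have : Algebra.FiniteType k (coordinateAlgebra k R E) := by
    rw [← Subalgebra.fg_iff_finiteType, heq]
    exact Subalgebra.fg_def.2 ⟨s, Set.finite_range _, rfl⟩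
  exact Algebra.FiniteType.isNoetherianRing k _

theorem IsRigid.function_exact {x : R →ₐ[k] E} (hx : x.IsRigid) :
    Function.Exact (diff₀ x x.toLinearMap) (diff₁ x x.toLinearMap) := by
  intro φ
  constructor
  · intro h
    obtain ⟨e, he⟩ := hx φ fun r s => by
      have := congr($h r s)
      rw [diff₁_apply, ← add_sub_assoc] at this
      exact (sub_eq_zero.1 this).symm
    exact ⟨e, LinearMap.ext fun r => by simp [he, diff₀_apply]⟩
  · rintro ⟨e, rfl⟩
    exact diff₁_diff₀ x x e

set_option maxSynthPendingDepth 3 in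
theorem IsRigid.exists_regular [FiniteDimensional k R] [FiniteDimensional k E]
    {x : R →ₐ[k] E} (hx : x.IsRigid) :
    ∃ F ∈ coordinateAlgebra k R E, F x ≠ 0 ∧
      ∀ y, F y ≠ 0 → ∃ u : Eˣ, ∀ r, y r * u = u * x r := by
  obtain ⟨s, t, hst⟩ := LinearMap.exists_homotopy_of_exact _ _ hx.function_exact
  let g (y : R →ₐ[k] E) : Module.End k (R →ₗ[k] E) :=
    diff₀ x y.toLinearMap ∘ₗ s + t ∘ₗ diff₁ x y.toLinearMap
  have hy := isRegularFamily_toLinearMap (k := k) (R := R) (E := E)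
  have hd₀ : IsRegularFamily (coordinateAlgebra k R E) (fun y => diff₀ x y.toLinearMap) := by
    unfold diff₀
    exact (hy.map leftDiff₀).sub (.const _)
  have hd₁ : IsRegularFamily (coordinateAlgebra k R E) (fun y => diff₁ x y.toLinearMap) := by
    unfold diff₁
    exact (hy.map leftDiff₁).add (.const _)
  have hg : IsRegularFamily (coordinateAlgebra k R E) g :=
    (hd₀.map (LinearMap.lcomp k _ s)).add (hd₁.map (LinearMap.compRight k t))
  obtain ⟨a, ha, hag⟩ := hg.exists_adjugate
  let v (y : R →ₐ[k] E) : E :=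
    LinearMap.det (g y) • 1 - s (a y (diff₀ x y.toLinearMap 1))
  have hv : IsRegularFamily (coordinateAlgebra k R E) v := by
    refine IsRegularFamily.sub (fun l => ?_)
      ((ha.bilin (hd₀.map (LinearMap.applyₗ 1)) LinearMap.id).map s)
    simp only [map_smul, smul_eq_mul, mul_comm _ (l 1)]
    exact (coordinateAlgebra k R E).smul_mem hg.det (l 1)
  refine ⟨_, mul_mem hg.det (hv.map (LinearMap.mul k E)).det, ?_, fun y hF => ?_⟩
  · have h1 : g x = LinearMap.id := hst
    have h2 : diff₀ x x.toLinearMap 1 = 0 := by ext; simp [diff₀_apply]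
    have h3 : LinearMap.mul k E 1 = LinearMap.id := by ext; simp
    simp [v, h1, h2, h3]
  · obtain ⟨h1, h2⟩ := mul_ne_zero_iff.1 hF
    have hgz (w) (hw : diff₁ x y.toLinearMap w = 0) :
        g y w = diff₀ x y.toLinearMap (s w) := by simp [g, hw]
    let Z := LinearMap.ker (diff₁ x y.toLinearMap)
    let gZ : Z →ₗ[k] Z := (g y).restrict fun w hw => by
      rw [hgz w hw]; exact diff₁_diff₀ x y _
    have hinj : Function.Injective gZ := by
      rw [← LinearMap.ker_eq_bot, LinearMap.ker_eq_bot']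
      intro w hw
      have : g y w = 0 := congr(($hw : R →ₗ[k] E))
      have h3 := hag y w
      rw [this, map_zero] at h3
      ext1
      exact (smul_eq_zero_iff_right h1).1 h3.symm
    obtain ⟨⟨w, hw⟩, hgw⟩ := LinearMap.surjective_of_injective hinj
      ⟨diff₀ x y.toLinearMap 1, diff₁_diff₀ x y 1⟩
    replace hgw : g y w = diff₀ x y.toLinearMap 1 := congr(($hgw : R →ₗ[k] E))
    have hv0 : diff₀ x y.toLinearMap (v y) = 0 := by
      simp only [v]
      rw [← hgw, hag, map_sub, map_smul, map_smul, map_smul, ← hgz w hw, hgw, sub_self]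
    have hbij : Function.Bijective (LinearMap.mul k E (v y)) :=
      (Module.End.isUnit_iff _).1 ((LinearMap.isUnit_iff_isUnit_det _).2 h2.isUnit)
    obtain ⟨w, hvw⟩ := hbij.2 1
    have hu : IsUnit (v y) := ⟨⟨v y, w, hvw, hbij.1 (by
      have : v y * w = 1 := hvw
      simp [← mul_assoc, this])⟩, rfl⟩
    refine ⟨hu.unit, fun r => ?_⟩
    have := congr($hv0 r)
    rw [diff₀_apply] at this
    exact sub_eq_zero.1 this

theorem exists_finite_rigid_representatives [FiniteDimensional k R] [FiniteDimensional k E] :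
    ∃ T : Set (R →ₐ[k] E), T.Finite ∧
      ∀ x : R →ₐ[k] E, x.IsRigid → ∃ z ∈ T, ∃ u : Eˣ, ∀ r, z r * u = u * x r := by
  let S := coordinateAlgebra k R E
  have : IsNoetherianRing S := coordinateAlgebra_isNoetherianRing
  choose F hFS hFx hF using fun x : {x : R →ₐ[k] E // x.IsRigid} => x.2.exists_regular
  have hp (x) : ∃ p : minimalPrimes S, (⟨F x, hFS x⟩ : S) ∉ p.1 := by
    by_contra! h
    have h1 : (⟨F x, hFS x⟩ : S) ∈ sInf (⊥ : Ideal S).minimalPrimes :=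
      Submodule.mem_sInf.2 fun p hp => h ⟨p, hp⟩
    rw [Ideal.sInf_minimalPrimes] at h1
    obtain ⟨n, hn⟩ := h1
    have h2 : F x x ^ n = 0 := congrFun (congrArg Subtype.val ((Submodule.mem_bot S).1 hn)) x.1
    exact hFx x (eq_zero_of_pow_eq_zero h2)
  choose c hc using hp
  have : _root_.Finite (minimalPrimes S) :=
    (minimalPrimes.finite_of_isNoetherianRing S).to_subtype
  obtain ⟨T, hT, hTc⟩ := exists_finite_set_of_finite_codomain c
  refine ⟨Subtype.val '' T, hT.image _, fun x hx => ?_⟩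
  obtain ⟨z, hz, hxz⟩ := hTc ⟨x, hx⟩
  refine ⟨z, ⟨z, hz, rfl⟩, ?_⟩
  have hprime : (c z).1.IsPrime := (c z).2.1.1
  have hmul : (⟨F ⟨x, hx⟩, hFS _⟩ : S) * ⟨F z, hFS z⟩ ∉ (c z).1 :=
    hprime.mul_notMem (hxz ▸ hc _) (hc z)
  obtain ⟨y, hy⟩ : ∃ y, F ⟨x, hx⟩ y * F z y ≠ 0 := by
    by_contra! h
    apply hmul
    convert (c z).1.zero_mem
    ext y
    exact h y
  obtain ⟨u, hu⟩ := hF ⟨x, hx⟩ y (left_ne_zero_of_mul hy)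
  obtain ⟨u', hu'⟩ := hF z y (right_ne_zero_of_mul hy)
  refine ⟨u'⁻¹ * u, fun r => ?_⟩
  have h1 : z.1 r = ↑u'⁻¹ * (y r * u') := by rw [hu', Units.inv_mul_cancel_left]
  rw [h1, Units.val_mul, mul_assoc, mul_assoc, Units.mul_inv_cancel_left, hu, mul_assoc]

end AlgHom

theorem length_restrictScalars_le {k R : Type*} [Field k] [CommRing R] [Algebra k R]
    {M : Type*} [AddCommGroup M] [Module R M] (h : IsFiniteLength R M) :
    ∀ [Module k M] [IsScalarTower k R M],
      Module.length k M ≤ Module.length R M * Module.length k R := by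
  induction h with
  | of_subsingleton => intros; simp
  | @of_simple_quotient M _ _ N hs _ ih =>
    intro _ _
    rw [Module.length_eq_add_of_exact N.subtype N.mkQ N.subtype_injective N.mkQ_surjective
      (LinearMap.exact_subtype_mkQ N), Module.length_eq_add_of_exact
      (N.subtype.restrictScalars k) (N.mkQ.restrictScalars k) N.subtype_injective
      N.mkQ_surjective (LinearMap.exact_subtype_mkQ N), add_mul,
      Module.length_eq_one R (M ⧸ N), one_mul]
    gcongr
    · exact ih
    · have := IsSimpleModule.nontrivial R (M ⧸ N)
      obtain ⟨x, hx⟩ := exists_ne (0 : M ⧸ N)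
      exact Module.length_le_of_surjective
        ((LinearMap.toSpanSingleton R (M ⧸ N) x).restrictScalars k)
        (IsSimpleModule.toSpanSingleton_surjective R hx)

theorem finrank_le_of_length_eq {k R : Type*} [Field k] [CommRing R] [Algebra k R]
    [FiniteDimensional k R]
    {M : Type*} [AddCommGroup M] [Module R M] [Module k M] [IsScalarTower k R M] {n : ℕ}
    (h : Module.length R M = n) :
    FiniteDimensional k M ∧ Module.finrank k M ≤ n * Module.finrank k R := by
  have hf : IsFiniteLength R M := Module.length_ne_top_iff.1 (by simp [h])
  have := (isFiniteLength_iff_isNoetherian_isArtinian.1 hf).1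
  have : Module.Finite k M := Module.Finite.trans R M
  refine ⟨this, ?_⟩
  have := length_restrictScalars_le (k := k) hf
  rw [h, Module.length_eq_finrank, Module.length_eq_finrank] at this
  exact_mod_cast this

theorem exists_extension_of_ext_one_subsingleton {R : Type} [CommRing R] {M N : ModuleCat.{0} R}
    (h : Subsingleton (extMod R M N 1)) (Q : ProjectiveResolution M)
    (f : Q.complex.X 1 ⟶ N) (hf : Q.complex.d 2 1 ≫ f = 0) :
    ∃ g : Q.complex.X 0 ⟶ N, Q.complex.d 1 0 ≫ g = f := by
  have hz : Limits.IsZero ((Q.complex.linearYonedaObj R N).homology 1) :=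
    (ModuleCat.isZero_of_subsingleton (extMod R M N 1)).of_iso (Q.isoExt 1 N).symm
  rw [← HomologicalComplex.exactAt_iff_isZero_homology,
    HomologicalComplex.exactAt_iff' _ 0 1 2 (by simp) (by simp),
    ShortComplex.moduleCat_exact_iff] at hz
  exact hz f hf

theorem exists_extension_of_projective {R P P' M N : Type*} [Ring R]
    [AddCommGroup P] [AddCommGroup P'] [AddCommGroup M] [AddCommGroup N]
    [Module R P] [Module R P'] [Module R M] [Module R N]
    [Module.Projective R P] [Module.Projective R P']
    (p : P →ₗ[R] M) (hp : Function.Surjective p)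
    (hext : ∀ ψ : LinearMap.ker p →ₗ[R] N, ∃ χ : P →ₗ[R] N, ∀ x : LinearMap.ker p, χ x = ψ x)
    (p' : P' →ₗ[R] M) (hp' : Function.Surjective p') (ψ : LinearMap.ker p' →ₗ[R] N) :
    ∃ χ : P' →ₗ[R] N, ∀ x : LinearMap.ker p', χ x = ψ x := by
  obtain ⟨a, ha⟩ := Module.projective_lifting_property p' p hp'
  obtain ⟨b, hb⟩ := Module.projective_lifting_property p p' hp
  have ha' (x) : p' (a x) = p x := LinearMap.congr_fun ha x
  have hb' (x) : p (b x) = p' x := LinearMap.congr_fun hb x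
  let c : P' →ₗ[R] LinearMap.ker p' :=
    (a ∘ₗ b - LinearMap.id).codRestrict _ fun x => by simp [ha', hb']
  obtain ⟨χ, hχ⟩ := hext (ψ ∘ₗ (a ∘ₗ (LinearMap.ker p).subtype).codRestrict _
    fun x => by simp [ha'])
  refine ⟨χ ∘ₗ b - ψ ∘ₗ c, fun x => ?_⟩
  have h1 := hχ ⟨b x, by simp [hb']⟩
  simp only [LinearMap.sub_apply, LinearMap.comp_apply] at h1 ⊢
  rw [h1, ← map_sub]
  congr 1
  ext
  exact sub_sub_cancel _ _

theorem exists_extension_ker {R : Type} [CommRing R] {M N : ModuleCat.{0} R}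
    (h : Subsingleton (extMod R M N 1)) {P : Type*} [AddCommGroup P] [Module R P]
    [Module.Projective R P] (p : P →ₗ[R] M) (hp : Function.Surjective p)
    (ψ : LinearMap.ker p →ₗ[R] N) :
    ∃ χ : P →ₗ[R] N, ∀ x : LinearMap.ker p, χ x = ψ x := by
  let Q := ProjectiveResolution.of M
  let q : Q.complex.X 0 ⟶ M := Q.π.f 0
  have hq : Function.Surjective q.hom :=
    (ModuleCat.epi_iff_surjective _).1 (inferInstanceAs (Epi (Q.π.f 0)))
  have : Module.Projective R (Q.complex.X 0) :=
    (IsProjective.iff_projective (R := R) (Q.complex.X 0)).2 (Q.projective 0)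
  refine exists_extension_of_projective q.hom hq (fun ψ => ?_) p hp ψ
  have hdq : Q.complex.d 1 0 ≫ q = 0 := Q.complex_d_comp_π_f_zero
  have hex : Function.Exact (Q.complex.d 1 0).hom q.hom :=
    (ShortComplex.ShortExact.moduleCat_exact_iff_function_exact _).1 Q.exact₀
  let d : Q.complex.X 1 →ₗ[R] LinearMap.ker q.hom :=
    (Q.complex.d 1 0).hom.codRestrict _ fun x => hex.apply_apply_eq_zero x
  obtain ⟨χ, hχ⟩ := exists_extension_of_ext_one_subsingleton h Q (ModuleCat.ofHom (ψ ∘ₗ d)) (by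
    ext x
    have : d ((Q.complex.d 2 1).hom x) = 0 := by
      ext
      exact congr($(Q.complex.d_comp_d 2 1 0) x)
    simp [this])
  refine ⟨χ.hom, fun ⟨x, hx⟩ => ?_⟩
  obtain ⟨y, rfl⟩ := (hex x).1 hx
  exact congr($hχ y)

open TensorProduct in
theorem exists_inner_of_cocycle {k R : Type} [Field k] [CommRing R] [Algebra k R]
    {N : ModuleCat.{0} R} [Module k N] [IsScalarTower k R N]
    (h : Subsingleton (extMod R N N 1)) (φ : R →ₗ[k] N →ₗ[k] N)
    (hφ : ∀ r s x, φ (r * s) x = r • φ s x + φ r (s • x)) :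
    ∃ g : N →ₗ[k] N, ∀ r x, φ r x = r • g x - g (r • x) := by
  let p : R ⊗[k] N →ₗ[R] N := (LinearMap.id : N →ₗ[k] N).liftBaseChange R
  let Φ : R ⊗[k] N →ₗ[k] N := TensorProduct.lift φ
  have hp : Function.Surjective p := fun x => ⟨1 ⊗ₜ x, by simp [p]⟩
  have hΦ (s : R) (t : R ⊗[k] N) : Φ (s • t) = s • Φ t + φ s (p t) := by
    induction t with
    | zero => simp
    | tmul r x => simp [Φ, p, TensorProduct.smul_tmul', hφ]
    | add t u ht hu => rw [smul_add, map_add, ht, hu, map_add, map_add, map_add, smul_add]; abel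
  have hφ_one (x : N) : φ 1 x = 0 := by simpa using hφ 1 1 x
  let ψ : LinearMap.ker p →ₗ[R] N :=
    { toFun := fun t => Φ t
      map_add' := fun t u => by simp
      map_smul' := fun s t => by
        have ht : p t = 0 := t.2
        simp [hΦ, ht] }
  obtain ⟨χ, hχ⟩ := exists_extension_ker h p hp ψ
  refine ⟨χ.restrictScalars k ∘ₗ TensorProduct.mk k R N 1, fun r x => ?_⟩
  have hker : r ⊗ₜ[k] x - 1 ⊗ₜ (r • x) ∈ LinearMap.ker p := by simp [p]
  have key : χ (r ⊗ₜ[k] x - 1 ⊗ₜ (r • x)) = Φ (r ⊗ₜ[k] x - 1 ⊗ₜ (r • x)) := hχ ⟨_, hker⟩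
  have hr : r ⊗ₜ[k] x = r • ((1 : R) ⊗ₜ[k] x) := by simp [TensorProduct.smul_tmul']
  rw [map_sub, map_sub, hr, map_smul] at key
  simpa [Φ, hφ_one, TensorProduct.smul_tmul'] using key.symm

theorem exists_rigid_algHom {k R : Type} [Field k] [CommRing R] [Algebra k R]
    {N : ModuleCat.{0} R} [Module k N] [IsScalarTower k R N] [FiniteDimensional k N]
    (h : Subsingleton (extMod R N N 1)) :
    ∃ x : R →ₐ[k] Module.End k (Fin (Module.finrank k N) → k), x.IsRigid ∧
      ∃ e : N ≃+ (Fin (Module.finrank k N) → k), ∀ r m, e (r • m) = x r (e m) := by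
  let e := (Module.finBasis k N).equivFun
  let x : R →ₐ[k] Module.End k (Fin (Module.finrank k N) → k) :=
    (e.conjAlgEquiv k).toAlgHom.comp (Algebra.lsmul k k N)
  have hx (r : R) (v) : x r v = e (r • e.symm v) := by simp [x]
  refine ⟨x, fun φ hφ => ?_, e.toAddEquiv, fun r m => ?_⟩
  · obtain ⟨g, hg⟩ := exists_inner_of_cocycle h ((e.symm.conjAlgEquiv k).toLinearMap ∘ₗ φ)
      fun r s m => by
        simp [hφ, hx]
    refine ⟨e.conjAlgEquiv k g, fun r => LinearMap.ext fun v => ?_⟩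
    have := congrArg e (hg r (e.symm v))
    simpa [hx] using this
  · exact .symm ((hx r (e m)).trans (by simp))

/-- Happel's finiteness: over a finite-dimensional commutative algebra over an
algebraically closed field, for each `n` the collection of modules `N` with
`Ext^1(N, N) = 0` and `len_R N = n` comprises finitely many isomorphism classes. -/
theorem happel_finiteness
    (k : Type) [Field k] [IsAlgClosed k]
    (R : Type) [CommRing R] [Algebra k R] [FiniteDimensional k R] (n : ℕ) :
    ∃ T : Set (ModuleCat R), T.Finite ∧
      ∀ N : ModuleCat R,
        Subsingleton (extMod R N N 1) → moduleLength R N = (n : WithBot ℕ∞) →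
          ∃ D ∈ T, Nonempty (N ≃ₗ[R] D) := by
  choose T hT hTx using fun d : ℕ =>
    AlgHom.exists_finite_rigid_representatives (k := k) (R := R) (E := Module.End k (Fin d → k))
  have hT' (d) : Finite (T d) := (hT d).to_subtype
  let α := {N : ModuleCat.{0} R // Subsingleton (extMod R N N 1) ∧ moduleLength R N = n}
  have key (N : α) : ∃ p : Σ d : Fin (n * Module.finrank k R + 1), T d,
      ∃ e : N.1 ≃+ (Fin p.1 → k), ∀ r m, e (r • m) = p.2.1 r (e m) := by
    obtain ⟨N, hN, hlen⟩ := N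
    let : Module k N := Module.compHom N (algebraMap k R)
    have : IsScalarTower k R N := .of_algebraMap_smul fun _ _ => rfl
    have hlen' : Module.length R N = n := by
      rw [moduleLength, ← Module.coe_length] at hlen
      exact_mod_cast hlen
    obtain ⟨_, hd⟩ := finrank_le_of_length_eq (k := k) hlen'
    obtain ⟨x, hx, e, he⟩ := exists_rigid_algHom (k := k) hN
    obtain ⟨z, hz, u, hu⟩ := hTx _ x hx
    refine ⟨⟨⟨_, Nat.lt_succ_of_le hd⟩, z, hz⟩,
      e.trans (LinearMap.GeneralLinearGroup.generalLinearEquiv k _ u).toAddEquiv, fun r m => ?_⟩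
    have h := LinearMap.congr_fun (hu r) (e m)
    simpa [he] using h.symm
  choose c e he using key
  obtain ⟨S, hS, hSc⟩ := exists_finite_set_of_finite_codomain c
  refine ⟨(fun N => ModuleCat.of R (ULift N.1)) '' S, hS.image _, fun N hN hlen => ?_⟩
  obtain ⟨D, hD, hND⟩ := hSc ⟨N, hN, hlen⟩
  refine ⟨_, ⟨D, hD, rfl⟩, ?_⟩
  obtain ⟨f, hf⟩ : ∃ f : N ≃+ (Fin (c D).1 → k), ∀ r m, f (r • m) = (c D).2.1 r (f m) := by
    rw [← hND]
    exact ⟨e ⟨N, hN, hlen⟩, he ⟨N, hN, hlen⟩⟩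
  refine ⟨LinearEquiv.trans { f.trans (e D).symm with map_smul' := fun r m => ?_ }
    (ULift.moduleEquiv (M := D.1)).symm⟩
  apply (e D).injective
  simp [hf, he]
end
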